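/- arXiv:2507.20949 — 7 statements merged into one kernel-verified Lean document; each statement's English description precedes it below -/
import Mathlib

section
/- Let n be a natural number with 2 ≤ n ≤ 9. Then the lattice I_{1,n} has exactly one orbit of primitive characteristic vectors of norm 9 − n under its automorphism group: for any two vectors u, v ∈ ℤ^{n+1} that are both primitive, characteristic, and satisfy ⟪u,u⟫ = ⟪v,v⟫ = 9 − n, there exists an integer matrix M with Mᵀ Ω M = Ω and M u = v. -/
open Matrix

/-- The Gram matrix `Ω = diag(1, -1, …, -1)` of the odd unimodular
Lorentzian lattice `I_{1,n}` on `ℤ^{n+1}`. -/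
def OmegaI (n : ℕ) : Matrix (Fin (n + 1)) (Fin (n + 1)) ℤ :=
  Matrix.diagonal (fun i => if i = 0 then 1 else -1)

/-- The bilinear form `⟪u,v⟫ = u₀v₀ - u₁v₁ - ⋯ - uₙvₙ` of `I_{1,n}`. -/
def formI (n : ℕ) (u v : Fin (n + 1) → ℤ) : ℤ := u ⬝ᵥ (OmegaI n).mulVec v

/-- A vector of `ℤ^{n+1}` is primitive if the gcd of its components is `1`. -/
def PrimitiveI (n : ℕ) (v : Fin (n + 1) → ℤ) : Prop := Finset.univ.gcd v = 1

/-- A vector is characteristic if `⟪v,x⟫ ≡ ⟪x,x⟫ (mod 2)` for every lattice vector `x`. -/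
def CharacteristicI (n : ℕ) (v : Fin (n + 1) → ℤ) : Prop :=
  ∀ x : Fin (n + 1) → ℤ, formI n v x ≡ formI n x x [ZMOD 2]

/-- Two vectors of `I_{1,n}` lie in the same orbit of the automorphism group. -/
def SameOrbit (n : ℕ) (u v : Fin (n + 1) → ℤ) : Prop :=
  ∃ M : Matrix (Fin (n + 1)) (Fin (n + 1)) ℤ, Mᵀ * OmegaI n * M = OmegaI n ∧ M.mulVec u = v

theorem formI_eq (n : ℕ) (u v : Fin (n + 1) → ℤ) :
    formI n u v = u 0 * v 0 - ∑ i : Fin n, u i.succ * v i.succ := by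
  simp [formI, OmegaI, dotProduct, mulVec_diagonal, Fin.sum_univ_succ, Fin.succ_ne_zero,
    sub_eq_add_neg]

theorem OmegaI_mul_self (n : ℕ) : OmegaI n * OmegaI n = 1 := by
  rw [OmegaI, diagonal_mul_diagonal, ← diagonal_one]
  congr 1
  ext i
  split_ifs <;> rfl

theorem formI_mulVec {n : ℕ} {M : Matrix (Fin (n + 1)) (Fin (n + 1)) ℤ}
    (hM : Mᵀ * OmegaI n * M = OmegaI n) (u v : Fin (n + 1) → ℤ) :
    formI n (M.mulVec u) (M.mulVec v) = formI n u v := by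
  rw [formI, formI, dotProduct_comm, dotProduct_mulVec, ← mulVec_transpose, dotProduct_comm]
  conv_rhs => rw [← hM]
  simp only [← mulVec_mulVec, Matrix.mul_assoc]

/-- The inverse of an automorphism is again an automorphism. -/
theorem exists_automorphism_inverse {n : ℕ} {M : Matrix (Fin (n + 1)) (Fin (n + 1)) ℤ}
    (hM : Mᵀ * OmegaI n * M = OmegaI n) :
    ∃ N : Matrix (Fin (n + 1)) (Fin (n + 1)) ℤ,
      Nᵀ * OmegaI n * N = OmegaI n ∧ N * M = 1 ∧ M * N = 1 := by
  have hNM : (OmegaI n * Mᵀ * OmegaI n) * M = 1 := by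
    rw [Matrix.mul_assoc, Matrix.mul_assoc, ← Matrix.mul_assoc Mᵀ, hM, OmegaI_mul_self]
  have hMN := mul_eq_one_comm.mp hNM
  refine ⟨_, ?_, hNM, hMN⟩
  generalize OmegaI n * Mᵀ * OmegaI n = N at hMN
  have hT : Nᵀ * Mᵀ = 1 := by rw [← transpose_mul, hMN, transpose_one]
  calc Nᵀ * OmegaI n * N = Nᵀ * (Mᵀ * OmegaI n * M) * N := by rw [hM]
    _ = (Nᵀ * Mᵀ) * OmegaI n * (M * N) := by simp only [Matrix.mul_assoc]
    _ = OmegaI n := by rw [hT, hMN, Matrix.one_mul, Matrix.mul_one]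

namespace SameOrbit

variable {n : ℕ} {u v w : Fin (n + 1) → ℤ}

theorem refl (u : Fin (n + 1) → ℤ) : SameOrbit n u u := ⟨1, by simp, by simp⟩

theorem symm (h : SameOrbit n u v) : SameOrbit n v u := by
  obtain ⟨M, hM, rfl⟩ := h
  obtain ⟨N, hN, hNM, -⟩ := exists_automorphism_inverse hM
  exact ⟨N, hN, by rw [mulVec_mulVec, hNM, one_mulVec]⟩

theorem trans (h : SameOrbit n u v) (h' : SameOrbit n v w) : SameOrbit n u w := by
  obtain ⟨M, hM, rfl⟩ := h
  obtain ⟨N, hN, rfl⟩ := h'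
  refine ⟨N * M, ?_, by rw [mulVec_mulVec]⟩
  calc (N * M)ᵀ * OmegaI n * (N * M) = Mᵀ * (Nᵀ * OmegaI n * N) * M := by
        simp only [transpose_mul, Matrix.mul_assoc]
    _ = OmegaI n := by rw [hN, hM]

theorem formI_self_eq (h : SameOrbit n u v) : formI n v v = formI n u u := by
  obtain ⟨M, hM, rfl⟩ := h
  exact formI_mulVec hM u u

theorem characteristicI (h : SameOrbit n u v) (hu : CharacteristicI n u) :
    CharacteristicI n v := by
  obtain ⟨M, hM, rfl⟩ := h
  obtain ⟨N, hN, -, hMN⟩ := exists_automorphism_inverse hM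
  intro x
  have hx : M.mulVec (N.mulVec x) = x := by rw [mulVec_mulVec, hMN, one_mulVec]
  have := hu (N.mulVec x)
  rwa [formI_mulVec hN x x, ← formI_mulVec hM, hx] at this

theorem dvd_of_forall_dvd (h : SameOrbit n u v) {c : ℤ} (hc : ∀ i, c ∣ v i)
    (i : Fin (n + 1)) : c ∣ u i := by
  obtain ⟨N, -, rfl⟩ := h.symm
  rw [mulVec, dotProduct]
  exact Finset.dvd_sum fun j _ => (hc j).mul_left _

end SameOrbit

theorem CharacteristicI.odd {n : ℕ} {v : Fin (n + 1) → ℤ} (hv : CharacteristicI n v)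
    (i : Fin (n + 1)) : Odd (v i) := by
  have h := hv (Pi.single i 1)
  rw [formI_eq, formI_eq] at h
  refine Fin.cases (fun h => ?_) (fun j h => ?_) i h
  · simpa [Int.odd_iff, Int.ModEq] using h
  · rw [Int.odd_iff]
    simp [Pi.single_apply, (Fin.succ_ne_zero _).symm, Int.ModEq] at h
    omega

/-- The reflection in `r` is an automorphism as soon as `-2 / ⟪r,r⟫` is an integer. -/
theorem sameOrbit_reflection {n : ℕ} {r : Fin (n + 1) → ℤ} {k : ℤ}
    (hr : k * formI n r r = -2) (u : Fin (n + 1) → ℤ) :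
    SameOrbit n u (u + (k * formI n r u) • r) := by
  set s := (OmegaI n).mulVec r with hs
  have hvec : r ᵥ* OmegaI n = s := by
    rw [hs, ← mulVec_transpose, OmegaI, diagonal_transpose]
  refine ⟨1 + k • vecMulVec r s, ?_, ?_⟩
  · have hrs : r ⬝ᵥ s = formI n r r := rfl
    simp only [transpose_add, transpose_one, transpose_smul, transpose_vecMulVec, Matrix.add_mul,
      Matrix.mul_add, Matrix.one_mul, Matrix.mul_one, Matrix.smul_mul, Matrix.mul_smul,
      vecMulVec_mul, mul_vecMulVec]
    rw [hvec, add_mulVec, smul_mulVec, vecMulVec_mulVec, ← hs, dotProduct_comm s r, hrs]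
    ext i j
    simp only [Matrix.add_apply, Matrix.smul_apply, vecMulVec_apply, Pi.add_apply, Pi.smul_apply,
      smul_eq_mul, op_smul_eq_smul]
    linear_combination k * s i * s j * hr
  · ext i
    have hsu : s ⬝ᵥ u = formI n r u := by
      rw [formI, dotProduct_mulVec, hvec]
    rw [add_mulVec, one_mulVec, smul_mulVec, vecMulVec_mulVec, hsu]
    simp only [Pi.add_apply, Pi.smul_apply, op_smul_eq_smul, smul_eq_mul, mul_assoc]

theorem sameOrbit_abs {n : ℕ} (u : Fin (n + 1) → ℤ) : SameOrbit n u fun i => |u i| := by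
  refine ⟨diagonal fun i => if 0 ≤ u i then 1 else -1, ?_, ?_⟩
  · rw [OmegaI, diagonal_transpose, diagonal_mul_diagonal, diagonal_mul_diagonal]
    congr 1
    ext i
    split_ifs <;> rfl
  · ext i
    rw [mulVec_diagonal]
    split_ifs with h
    · rw [abs_of_nonneg h, one_mul]
    · rw [abs_of_neg (not_le.mp h), neg_one_mul]

/-- Every orbit contains a nonnegative vector whose zeroth coordinate is minimal. -/
theorem exists_sameOrbit_minimal {n : ℕ} (u : Fin (n + 1) → ℤ) :
    ∃ v, SameOrbit n u v ∧ (∀ i, 0 ≤ v i) ∧ ∀ w, SameOrbit n v w → v 0 ≤ |w 0| := by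
  obtain ⟨v, hv, hmin⟩ := (measure fun w : Fin (n + 1) → ℤ => (w 0).natAbs).wf.has_min
    {w | SameOrbit n u w} ⟨u, SameOrbit.refl u⟩
  refine ⟨_, SameOrbit.trans hv (sameOrbit_abs v), fun i => abs_nonneg _, fun w hw => ?_⟩
  have h : ¬ (w 0).natAbs < (v 0).natAbs :=
    hmin w (SameOrbit.trans hv ((sameOrbit_abs v).trans hw))
  simp only [Int.abs_eq_natAbs]
  omega

/-- A vector whose zeroth coordinate is minimal lies on the positive side of the mirrors of
the reflections in `e₀ + ∑ i ∈ S, eᵢ`. -/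
theorem sum_le_of_minimal {n : ℕ} {v : Fin (n + 1) → ℤ} (hmin : ∀ w, SameOrbit n v w → v 0 ≤ |w 0|)
    (h0 : 0 < v 0) (hnorm : 0 ≤ formI n v v) (S : Finset (Fin n)) {k : ℤ}
    (hk : 0 < k) (hS : k * (S.card - 1) = 2) : ∑ i ∈ S, v i.succ ≤ v 0 := by
  classical
  by_contra! hlt
  let r : Fin (n + 1) → ℤ := Fin.cons 1 fun i => if i ∈ S then 1 else 0
  have hrr : k * formI n r r = -2 := by
    have : formI n r r = 1 - S.card := by simp [formI_eq, r]
    rw [this]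
    linarith
  have hrv : formI n r v = v 0 - ∑ i ∈ S, v i.succ := by simp [formI_eq, r]
  have hle := hmin _ (sameOrbit_reflection hrr v)
  have hw : (v + (k * formI n r v) • r) 0 = v 0 + k * (v 0 - ∑ i ∈ S, v i.succ) := by
    simp [hrv, r]
  rw [hw] at hle
  have hsq : (∑ i ∈ S, v i.succ) ^ 2 ≤ S.card * ∑ i ∈ S, v i.succ ^ 2 :=
    sq_sum_le_card_mul_sum_sq
  have hsub : ∑ i ∈ S, v i.succ ^ 2 ≤ ∑ i : Fin n, v i.succ ^ 2 :=
    Finset.sum_le_sum_of_subset_of_nonneg S.subset_univ fun i _ _ => sq_nonneg _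
  have hv0 : ∑ i : Fin n, v i.succ ^ 2 ≤ v 0 ^ 2 := by
    rw [formI_eq] at hnorm
    simpa only [sq, sub_nonneg] using hnorm
  set t := ∑ i ∈ S, v i.succ
  set s : ℤ := (S.card : ℤ)
  have hs : 1 < s := by
    by_contra! h
    nlinarith
  have hneg : k * (v 0 - t) < 0 := mul_neg_of_pos_of_neg hk (by linarith)
  have hst : s * v 0 ≤ t := by
    rcases le_abs.mp hle with h | h
    · linarith
    · have : k * (s * v 0) ≤ k * t := by linear_combination h + v 0 * hS
      exact le_of_mul_le_mul_left this hk
  have h1 : (s * v 0) ^ 2 ≤ t ^ 2 := pow_le_pow_left₀ (by positivity) hst 2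
  have h2 : s * ∑ i ∈ S, v i.succ ^ 2 ≤ s * v 0 ^ 2 :=
    mul_le_mul_of_nonneg_left (hsub.trans hv0) (by linarith)
  have h3 : 0 < s * (s - 1) * v 0 ^ 2 := by
    have : 0 < s - 1 := by linarith
    positivity
  nlinarith

/-- The three largest values of a function on a finite set with at least three elements. -/
theorem exists_three_largest {ι : Type*} [Fintype ι] [DecidableEq ι] (h : 3 ≤ Fintype.card ι)
    (f : ι → ℤ) : ∃ i j k, i ≠ j ∧ i ≠ k ∧ j ≠ k ∧ f j ≤ f i ∧ f k ≤ f j ∧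
      ∀ l ∉ ({i, j, k} : Finset ι), f l ≤ f k := by
  have key : ∀ S : Finset ι, S.card < 3 → ∃ i ∉ S, ∀ l ∉ S, f l ≤ f i := by
    intro S hS
    have hne : Sᶜ.Nonempty := by
      rw [← Finset.card_pos, Finset.card_compl]
      omega
    obtain ⟨i, hi, hmax⟩ := Finset.exists_max_image Sᶜ f hne
    exact ⟨i, Finset.mem_compl.mp hi, fun l hl => hmax l (Finset.mem_compl.mpr hl)⟩
  obtain ⟨i, -, hi⟩ := key ∅ (by simp)
  obtain ⟨j, hj, hj'⟩ := key {i} (by simp)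
  obtain ⟨k, hk, hk'⟩ := key {i, j} (Finset.card_le_two.trans_lt (by norm_num))
  simp only [Finset.mem_insert, Finset.mem_singleton, not_or] at *
  exact ⟨i, j, k, Ne.symm hj, Ne.symm hk.1, Ne.symm hk.2, hi j (by simp), hj' k hk.1,
    fun l hl => hk' l ⟨hl.1, hl.2.1⟩⟩

theorem eq_const_of_triple_sum_le {n : ℕ} (hn3 : 3 ≤ n) (hn9 : n ≤ 9) {a : ℤ} {f : Fin n → ℤ}
    (hf : ∀ i, 0 < f i) (hnorm : a ^ 2 - ∑ i, f i ^ 2 = 9 - n)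
    (htriple : ∀ S : Finset (Fin n), S.card = 3 → ∑ i ∈ S, f i ≤ a) :
    ∃ c, a = 3 * c ∧ ∀ i, f i = c := by
  obtain ⟨i, j, k, hij, hik, hjk, hfij, hfjk, hmax⟩ := exists_three_largest (by simpa using hn3) f
  set T : Finset (Fin n) := {i, j, k}
  have hT : T.card = 3 := Finset.card_eq_three.mpr ⟨i, j, k, hij, hik, hjk, rfl⟩
  have hsum (g : Fin n → ℤ) : ∑ l ∈ T, g l = g i + g j + g k := by
    simp [T, hij, hik, hjk, add_assoc]
  have ha := htriple T hT
  rw [hsum] at ha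
  have hk := hf k
  have hsplit := Finset.sum_add_sum_compl T fun l => f l ^ 2
  rw [hsum] at hsplit
  have hterm : ∀ l ∈ Tᶜ, f l ^ 2 ≤ f k ^ 2 := fun l hl =>
    pow_le_pow_left₀ (hf l).le (hmax l (Finset.mem_compl.mp hl)) 2
  have hconst : ∑ _l ∈ Tᶜ, f k ^ 2 = (n - 3) * f k ^ 2 := by
    rw [Finset.sum_const, Finset.card_compl, hT, Fintype.card_fin, nsmul_eq_mul]
    push_cast [hn3]
    ring
  have hrest := Finset.sum_le_sum hterm
  rw [hconst] at hrest
  have hasq : (f i + f j + f k) ^ 2 ≤ a ^ 2 := pow_le_pow_left₀ (by linarith) ha 2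
  have hn : (0 : ℤ) ≤ 9 - n := by
    have : (n : ℤ) ≤ 9 := by exact_mod_cast hn9
    linarith
  have hc : 0 ≤ (9 - n) * (f k ^ 2 - 1) := mul_nonneg hn (by nlinarith)
  have h1 : 0 ≤ (f i - f k) * f k := mul_nonneg (by linarith) hk.le
  have h2 : 0 ≤ (f j - f k) * f k := mul_nonneg (by linarith) hk.le
  have h3 : 0 ≤ (f i - f k) * (f j - f k) := mul_nonneg (by linarith) (by linarith)
  have hi : f i = f k := by
    have : (f i - f k) * f k = 0 := by nlinarith
    rcases mul_eq_zero.mp this with h | h <;> linarith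
  have hj : f j = f k := by
    have : (f j - f k) * f k = 0 := by nlinarith
    rcases mul_eq_zero.mp this with h | h <;> linarith
  rw [hi, hj] at hsplit hasq ha
  have hrest' : ∑ l ∈ Tᶜ, f l ^ 2 = ∑ _l ∈ Tᶜ, f k ^ 2 := by
    rw [hconst]
    nlinarith
  have ha' : a ^ 2 = (3 * f k) ^ 2 := by nlinarith
  refine ⟨f k, (sq_eq_sq₀ (by linarith) (by linarith)).mp ha', fun l => ?_⟩
  by_cases hl : l ∈ T
  · simp only [T, Finset.mem_insert, Finset.mem_singleton] at hl
    rcases hl with rfl | rfl | rfl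
    exacts [hi, hj, rfl]
  · have := (Finset.sum_eq_sum_iff_of_le hterm).mp hrest' l (Finset.mem_compl.mpr hl)
    exact (sq_eq_sq₀ (hf l).le hk.le).mp this

theorem eq_of_sq_sub_sq_sub_sq_eq_seven {a b c : ℤ} (hb : 0 < b) (hc : 0 < c) (hb' : Odd b)
    (hc' : Odd c) (h : a ^ 2 - (b ^ 2 + c ^ 2) = 7) (hle : b + c ≤ a) :
    a = 3 ∧ b = 1 ∧ c = 1 := by
  have hbc : b * c ≤ 3 := by nlinarith
  have hb3 : b ≤ 3 := by nlinarith
  have hc3 : c ≤ 3 := by nlinarith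
  have ha : a ≤ 5 := by nlinarith
  have ha' : 0 < a := by linarith
  rw [Int.odd_iff] at hb' hc'
  interval_cases b <;> interval_cases c <;> first | omega | (interval_cases a <;> omega)

/-- Every primitive characteristic vector of norm `9 - n` is in the orbit of `(3, 1, …, 1)`. -/
theorem sameOrbit_cons_three_one {n : ℕ} (hn2 : 2 ≤ n) (hn9 : n ≤ 9) {u : Fin (n + 1) → ℤ}
    (hprim : PrimitiveI n u) (hchar : CharacteristicI n u) (hnorm : formI n u u = 9 - (n : ℤ)) :
    SameOrbit n u (Fin.cons 3 fun _ => 1) := by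
  obtain ⟨v, huv, hnonneg, hmin⟩ := exists_sameOrbit_minimal u
  have hodd := (huv.characteristicI hchar).odd
  have hpos (i) : 0 < v i := by
    have := hnonneg i
    have := Int.odd_iff.mp (hodd i)
    omega
  rw [← huv.formI_self_eq] at hnorm
  have hnorm0 : 0 ≤ formI n v v := by
    rw [hnorm]
    omega
  have hmirror := sum_le_of_minimal hmin (hpos 0) hnorm0
  simp only [formI_eq, ← sq] at hnorm
  obtain ⟨c, hc0, hc⟩ : ∃ c, v 0 = 3 * c ∧ ∀ i : Fin n, v i.succ = c := by
    obtain rfl | hn3 := hn2.eq_or_lt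
    · have h := hmirror Finset.univ (k := 2) (by norm_num) (by simp)
      rw [Fin.sum_univ_two] at hnorm h
      obtain ⟨h0, h1, h2⟩ := eq_of_sq_sub_sq_sub_sq_eq_seven (hpos _) (hpos _) (hodd _) (hodd _)
        (hnorm.trans (by norm_num)) h
      exact ⟨1, h0, Fin.forall_fin_two.mpr ⟨h1, h2⟩⟩
    · exact eq_const_of_triple_sum_le hn3 hn9 (fun i => hpos i.succ) hnorm fun S hS =>
        hmirror S (k := 1) one_pos (by simp [hS])
  have hc1 : c ∣ 1 := by
    rw [← hprim]
    refine Finset.dvd_gcd fun i _ => huv.dvd_of_forall_dvd (Fin.cases ?_ fun j => ?_) i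
    · exact hc0 ▸ dvd_mul_left c 3
    · exact (hc j).symm.dvd
  have hcpos : 0 < c := by
    have := hpos 0
    omega
  have hc1 : c = 1 := Int.eq_one_of_dvd_one hcpos.le hc1
  convert huv using 1
  ext i
  refine Fin.cases ?_ (fun j => ?_) i
  · simp [hc0, hc1]
  · simp [hc, hc1]

/-- For `2 ≤ n ≤ 9`, the lattice `I_{1,n}` has exactly one orbit of primitive
characteristic vectors of norm `9 - n` under its automorphism group. -/
theorem single_orbit_primitive_characteristic_norm_nine_sub (n : ℕ)
    (hn2 : 2 ≤ n) (hn9 : n ≤ 9)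
    (u v : Fin (n + 1) → ℤ)
    (hu_prim : PrimitiveI n u) (hv_prim : PrimitiveI n v)
    (hu_char : CharacteristicI n u) (hv_char : CharacteristicI n v)
    (hu_norm : formI n u u = 9 - (n : ℤ)) (hv_norm : formI n v v = 9 - (n : ℤ)) :
    ∃ M : Matrix (Fin (n + 1)) (Fin (n + 1)) ℤ,
      Mᵀ * OmegaI n * M = OmegaI n ∧ M.mulVec u = v := by
  exact (sameOrbit_cons_three_one hn2 hn9 hu_prim hu_char hu_norm).trans
    (sameOrbit_cons_three_one hn2 hn9 hv_prim hv_char hv_norm).symm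
end

section
/- For every natural number n ≥ 1 and every natural number m ≥ 1, the lattice II_{1,8n+1} has exactly one orbit of primitive vectors of norm −2m under its automorphism group: for any two vectors u, v ∈ ℤ^{8n+2} that are both primitive and satisfy uᵀ G_n u = vᵀ G_n v = −2m, there exists an integer matrix M with Mᵀ G_n M = G_n and M u = v. -/
open Matrix

/-- The Gram (Cartan) matrix of the root lattice `E₈`. -/
def E8Gram : Matrix (Fin 8) (Fin 8) ℤ :=
  !![ 2,  0, -1,  0,  0,  0,  0,  0;
      0,  2,  0, -1,  0,  0,  0,  0;
     -1,  0,  2, -1,  0,  0,  0,  0;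
      0, -1, -1,  2, -1,  0,  0,  0;
      0,  0,  0, -1,  2, -1,  0,  0;
      0,  0,  0,  0, -1,  2, -1,  0;
      0,  0,  0,  0,  0, -1,  2, -1;
      0,  0,  0,  0,  0,  0, -1,  2]

/-- The Gram matrix of the even unimodular Lorentzian lattice `II_{1,8n+1}`,
the block-diagonal sum of `U = [[0,1],[1,0]]` and `n` copies of `-E₈`. -/
def IIGram (n : ℕ) : Matrix (Fin (8 * n + 2)) (Fin (8 * n + 2)) ℤ := fun i j =>
  if (i : ℕ) = 0 ∧ (j : ℕ) = 1 then 1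
  else if (i : ℕ) = 1 ∧ (j : ℕ) = 0 then 1
  else if 2 ≤ (i : ℕ) ∧ 2 ≤ (j : ℕ) ∧ ((i : ℕ) - 2) / 8 = ((j : ℕ) - 2) / 8 then
    -(E8Gram ⟨((i : ℕ) - 2) % 8, Nat.mod_lt _ (by norm_num)⟩
             ⟨((j : ℕ) - 2) % 8, Nat.mod_lt _ (by norm_num)⟩)
  else 0

section HyperbolicSum

variable {K : Type*} [AddCommGroup K]

/-- The bilinear form of `U ⊕ (-K)`, where `K` carries the bilinear form `B`. -/
def hyperbolicForm (B : K →ₗ[ℤ] K →ₗ[ℤ] ℤ) (x y : ℤ × ℤ × K) : ℤ :=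
  x.1 * y.2.1 + x.2.1 * y.1 - B x.2.2 y.2.2

/-- Some isometric embedding of `U ⊕ (-K)` into itself maps `v` to `(1, -m, 0)`. -/
def IsStandardizable (B : K →ₗ[ℤ] K →ₗ[ℤ] ℤ) (m : ℤ) (v : ℤ × ℤ × K) : Prop :=
  ∃ g : (ℤ × ℤ × K) →ₗ[ℤ] (ℤ × ℤ × K),
    (∀ x y, hyperbolicForm B (g x) (g y) = hyperbolicForm B x y) ∧ g v = (1, -m, 0)

/-- No non-unit integer divides the vector `v`. -/
def IsPrimitiveVec (v : ℤ × ℤ × K) : Prop :=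
  ∀ d : ℤ, d ∣ v.1 → d ∣ v.2.1 → (∃ x : K, v.2.2 = d • x) → IsUnit d

/-- The Eichler transvection attached to an isotropic basis vector of `U` and `u ∈ K`. -/
def eichlerTransvection (B : K →ₗ[ℤ] K →ₗ[ℤ] ℤ) (q : K → ℤ) (u : K) :
    (ℤ × ℤ × K) →ₗ[ℤ] (ℤ × ℤ × K) where
  toFun x := (x.1, x.2.1 + B x.2.2 u + x.1 * q u, x.2.2 + x.1 • u)
  map_add' x y := by
    ext
    · simp
    · simp; ring
    · simp [add_smul]; abel
  map_smul' c x := by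
    ext
    · simp
    · simp; ring
    · simp [mul_smul]

/-- The isometry interchanging the two isotropic basis vectors of `U`. -/
def hyperbolicSwap : (ℤ × ℤ × K) →ₗ[ℤ] (ℤ × ℤ × K) where
  toFun x := (x.2.1, x.1, x.2.2)
  map_add' _ _ := rfl
  map_smul' _ _ := rfl

/-- The similarity `(x, y, z) ↦ (x, k² y, k z)` of `U ⊕ (-K)`. -/
def hyperbolicScaling (k : ℤ) : (ℤ × ℤ × K) →ₗ[ℤ] (ℤ × ℤ × K) where
  toFun x := (x.1, k ^ 2 * x.2.1, k • x.2.2)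
  map_add' x y := by
    ext
    · simp
    · simp; ring
    · simp
  map_smul' c x := by
    ext
    · simp
    · simp; ring
    · simp [smul_comm c k]

variable {B : K →ₗ[ℤ] K →ₗ[ℤ] ℤ} {q : K → ℤ}

lemma quadratic_add (hs : ∀ x y, B x y = B y x) (hq : ∀ x, B x x = 2 * q x) (x y : K) :
    q (x + y) = q x + q y + B x y := by
  have h := hq (x + y)
  simp only [map_add, LinearMap.add_apply, hq, hs y x] at h
  linarith

lemma quadratic_smul (hq : ∀ x, B x x = 2 * q x) (c : ℤ) (x : K) :
    q (c • x) = c ^ 2 * q x := by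
  have h := hq (c • x)
  simp only [map_smul, LinearMap.smul_apply, hq, smul_eq_mul] at h
  linarith

lemma hyperbolicForm_eichlerTransvection (hs : ∀ x y, B x y = B y x)
    (hq : ∀ x, B x x = 2 * q x) (u : K) (x y : ℤ × ℤ × K) :
    hyperbolicForm B (eichlerTransvection B q u x) (eichlerTransvection B q u y) =
      hyperbolicForm B x y := by
  simp only [hyperbolicForm, eichlerTransvection, LinearMap.coe_mk, AddHom.coe_mk, map_add,
    map_smul, LinearMap.add_apply, LinearMap.smul_apply, hq, smul_eq_mul, hs u]
  ring

lemma IsStandardizable.of_isometry {m : ℤ} {v : ℤ × ℤ × K}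
    (f : (ℤ × ℤ × K) →ₗ[ℤ] (ℤ × ℤ × K))
    (hf : ∀ x y, hyperbolicForm B (f x) (f y) = hyperbolicForm B x y)
    (h : IsStandardizable B m (f v)) : IsStandardizable B m v := by
  obtain ⟨g, hg, hgv⟩ := h
  exact ⟨g ∘ₗ f, fun x y => by simp [hg, hf], by simpa using hgv⟩

lemma IsStandardizable.of_eichlerTransvection (hs : ∀ x y, B x y = B y x)
    (hq : ∀ x, B x x = 2 * q x) {m a b : ℤ} {l : K} (u : K)
    (h : IsStandardizable B m (a, b + B l u + a * q u, l + a • u)) :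
    IsStandardizable B m (a, b, l) :=
  IsStandardizable.of_isometry (eichlerTransvection B q u)
    (hyperbolicForm_eichlerTransvection hs hq u) h

lemma IsStandardizable.of_swap {m a b : ℤ} {l : K} (h : IsStandardizable B m (b, a, l)) :
    IsStandardizable B m (a, b, l) :=
  IsStandardizable.of_isometry hyperbolicSwap
    (fun x y => by simp only [hyperbolicForm, hyperbolicSwap, LinearMap.coe_mk,
      AddHom.coe_mk]; ring) h

lemma IsStandardizable.of_neg {m a b : ℤ} {l : K} (h : IsStandardizable B m (-a, -b, -l)) :
    IsStandardizable B m (a, b, l) :=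
  IsStandardizable.of_isometry (-LinearMap.id) (fun x y => by simp [hyperbolicForm]) h

/-- An isometry standardizing `(a, k² b, k l)` is conjugated by the similarity
`(x, y, z) ↦ (x, k² y, k z)` into one standardizing `(a, b, l)`. -/
lemma IsStandardizable.of_scaling [Module.IsTorsionFree ℤ K]
    {m a b k : ℤ} {l : K} (hk : k ≠ 0) (hak : IsCoprime k a)
    (h : IsStandardizable B (m * k ^ 2) (a, k ^ 2 * b, k • l)) :
    IsStandardizable B m (a, b, l) := by
  obtain ⟨g, hg, hgv⟩ := h
  let T : (ℤ × ℤ × K) →ₗ[ℤ] (ℤ × ℤ × K) := hyperbolicScaling k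
  have hT : ∀ x, T x = (x.1, k ^ 2 * x.2.1, k • x.2.2) := fun _ => rfl
  have hTinj : Function.Injective T := by
    rintro ⟨x, y, z⟩ ⟨x', y', z'⟩ hxy
    simp only [hT, Prod.mk.injEq] at hxy
    obtain ⟨h1, h2, h3⟩ := hxy
    rw [h1, mul_left_cancel₀ (pow_ne_zero 2 hk) h2, smul_right_injective K hk h3]
  have hTform : ∀ x y, hyperbolicForm B (T x) (T y) = k ^ 2 * hyperbolicForm B x y := by
    intro x y
    simp only [hyperbolicForm, hT, map_smul, LinearMap.smul_apply, smul_eq_mul]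
    ring
  have hrange : ∀ x, ∃ y, T y = g (T x) := by
    rintro ⟨x, y, z⟩
    obtain ⟨r, s, hrs⟩ : IsCoprime (k ^ 2) a := hak.pow_left
    set w : ℤ × ℤ × K := (k * (r * x), k * (y - x * s * b), z - (x * s) • l) with hw
    have hsplit : T (x, y, z) = (x * s) • (a, k ^ 2 * b, k • l) + k • w := by
      rw [hT, hw]
      ext
      · simp; linear_combination (-x) * hrs
      · simp; ring
      · simp [smul_sub, smul_comm k (x * s)]
    have hdvd : k ∣ (g w).2.1 := by
      have h1 := hg w (a, k ^ 2 * b, k • l)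
      rw [hgv] at h1
      simp only [hyperbolicForm, hw, map_zero, map_smul, smul_eq_mul] at h1
      refine ⟨(g w).1 * m * k + r * x * (k ^ 2 * b) + (y - x * s * b) * a
        - B (z - (x * s) • l) l, ?_⟩
      rw [← hw] at h1
      linear_combination h1
    obtain ⟨c, hc⟩ := hdvd
    refine ⟨((g (T (x, y, z))).1, -(x * s) * m + c, (g w).2.2), ?_⟩
    rw [hT, hsplit, map_add, map_smul, map_smul, hgv]
    ext
    · simp
    · simp [hc]; ring
    · simp
  choose f hf using hrange
  refine ⟨⟨⟨f, fun x y => hTinj ?_⟩, fun c x => hTinj ?_⟩, fun x y => ?_, hTinj ?_⟩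
  · simp only [map_add, hf]
  · simp only [map_smul, hf, RingHom.id_apply]
  · refine mul_left_cancel₀ (pow_ne_zero 2 hk) ?_
    change k ^ 2 * hyperbolicForm B (f x) (f y) = _
    rw [← hTform, hf, hf, hg, hTform]
  · change T (f (a, b, l)) = _
    rw [hf]
    change g (a, k ^ 2 * b, k • l) = _
    rw [hgv, hT]
    simp [mul_comm]

/-- Either the form `(k, u) ↦ b k² + k B(l, u) + a q(u)` takes a value in `(0, a)` with `k` prime
to `a`, or `B(l, ·)` vanishes modulo `a` on the orthogonal complement of `e`. -/
lemma exists_small_value_or_dvd (hs : ∀ x y, B x y = B y x) (hq : ∀ x, B x x = 2 * q x)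
    {m a b : ℤ} {l e w : K} (ha : 2 ≤ a) (hm : a * b - q l = -m) (he : q e = m)
    (hw : B w e = 1) :
    (∃ (k : ℤ) (u : K), IsCoprime k a ∧ 0 < b * k ^ 2 + k * B l u + a * q u ∧
      b * k ^ 2 + k * B l u + a * q u < a) ∨
    ((∀ x, B x e = 0 → a ∣ B l x) ∧ ∃ u, a ∣ b + B l u) := by
  have hline : ∀ (u : K) (t : ℤ),
      b * (1 + t * a) ^ 2 + (1 + t * a) * B l (u + t • (e - l)) + a * q (u + t • (e - l)) =
        (b + B l u + a * q u) + t * (B l e - 2 * m + a * B u e) := by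
    intro u t
    have h1 : q (e - l) = q e + q l - B l e := by
      have h2 := quadratic_add hs hq (e - l) l
      rw [sub_add_cancel, map_sub, LinearMap.sub_apply, hq, hs e l] at h2
      linarith
    rw [quadratic_add hs hq, quadratic_smul hq, h1, he]
    simp only [map_add, map_sub, map_smul, smul_eq_mul, hq, hs u l]
    have h3 : q l = a * b + m := by linarith
    rw [h3]
    ring
  have hcop : ∀ t : ℤ, IsCoprime (1 + t * a) a := fun t => ⟨1, -t, by ring⟩
  by_cases hr : a ∣ B l e - 2 * m
  · obtain ⟨c, hc⟩ := hr
    by_cases hall : ∀ x, B x e = 0 → a ∣ b + B l ((1 - c) • w + x)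
    · have h0 := hall 0 (by simp)
      refine Or.inr ⟨fun x hx => ?_, _, h0⟩
      have h1 := dvd_sub (hall x hx) h0
      simpa using h1
    · push Not at hall
      obtain ⟨x, hx, hnd⟩ := hall
      set u := (1 - c) • w + x with hu
      have hue : B l e - 2 * m + a * B u e = a := by
        simp only [hu, map_add, map_smul, LinearMap.add_apply, LinearMap.smul_apply, hw, hx,
          smul_eq_mul]
        linear_combination hc
      refine Or.inl ⟨1 + -((b + B l u + a * q u) / a) * a,
        u + -((b + B l u + a * q u) / a) • (e - l), hcop _, ?_⟩
      rw [hline, hue]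
      have hmod : b + B l u + a * q u + -((b + B l u + a * q u) / a) * a =
          (b + B l u + a * q u) % a := by
        rw [Int.emod_def]; ring
      rw [hmod]
      refine ⟨lt_of_le_of_ne (Int.emod_nonneg _ (by omega)) fun h0 => hnd ?_,
        Int.emod_lt_of_pos _ (by omega)⟩
      have h1 := Int.dvd_of_emod_eq_zero h0.symm
      exact (dvd_add_left (dvd_mul_right a _)).1 h1
  · left
    set s := (B l e - 2 * m) % a with hsdef
    have hs0 : 0 < s := lt_of_le_of_ne (Int.emod_nonneg _ (by omega))
      fun h0 => hr (Int.dvd_of_emod_eq_zero h0.symm)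
    have hsa : s < a := Int.emod_lt_of_pos _ (by omega)
    set u := -((B l e - 2 * m) / a) • w with hu
    have hue : B l e - 2 * m + a * B u e = s := by
      rw [hsdef, Int.emod_def, hu]
      simp only [map_smul, LinearMap.smul_apply, hw, smul_eq_mul]
      ring
    set Q := b + B l u + a * q u with hQ
    refine ⟨1 + -((Q - 1) / s) * a, u + -((Q - 1) / s) • (e - l), hcop _, ?_⟩
    rw [hline, hue, ← hQ]
    have hmod : Q + -((Q - 1) / s) * s = (Q - 1) % s + 1 := by
      rw [Int.emod_def]; ring
    rw [hmod]
    have h1 := Int.emod_nonneg (Q - 1) hs0.ne'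
    have h2 := Int.emod_lt_of_pos (Q - 1) hs0
    omega

/-- Two vectors of norm `2m` in `K`, with one dual to the first and orthogonal to the second. -/
def HasSeparatedPair (B : K →ₗ[ℤ] K →ₗ[ℤ] ℤ) (q : K → ℤ) (m : ℤ) : Prop :=
  ∃ e e' w w' : K, q e = m ∧ q e' = m ∧ B w e = 1 ∧ B w e' = 0 ∧ B w' e' = 1

lemma exists_small_value (hs : ∀ x y, B x y = B y x) (hq : ∀ x, B x x = 2 * q x)
    (hdual : ∀ (d : ℤ) (x : K), (∀ y, d ∣ B x y) → ∃ z, x = d • z)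
    {m a b : ℤ} {l : K} (hpair : HasSeparatedPair B q m) (ha : 2 ≤ a)
    (hm : a * b - q l = -m) (hprim : IsPrimitiveVec (a, b, l)) :
    ∃ (k : ℤ) (u : K), IsCoprime k a ∧ 0 < b * k ^ 2 + k * B l u + a * q u ∧
      b * k ^ 2 + k * B l u + a * q u < a := by
  obtain ⟨e, e', w, w', he, he', hwe, hwe', hw'e'⟩ := hpair
  rcases exists_small_value_or_dvd hs hq ha hm he hwe with h | ⟨horth, u, hu⟩
  · exact h
  rcases exists_small_value_or_dvd hs hq ha hm he' hw'e' with h | ⟨horth', -⟩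
  · exact h
  have hall : ∀ x, a ∣ B l x := by
    intro x
    have h1 : a ∣ B l (x - B x e • w) := horth _ (by simp [hwe])
    have h2 : a ∣ B x e * B l w := (horth' w hwe').mul_left _
    simpa using dvd_add h1 h2
  have hunit := hprim a dvd_rfl ((dvd_add_left (hall u)).1 hu) (hdual a l hall)
  rw [Int.isUnit_iff] at hunit
  omega

lemma isStandardizable_of_ne_zero [Module.IsTorsionFree ℤ K] (hs : ∀ x y, B x y = B y x)
    (hq : ∀ x, B x x = 2 * q x)
    (hdual : ∀ (d : ℤ) (x : K), (∀ y, d ∣ B x y) → ∃ z, x = d • z)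
    (hpair : ∀ m : ℤ, 1 ≤ m → HasSeparatedPair B q m)
    {m a b : ℤ} {l : K} (hm1 : 1 ≤ m) (ha : a ≠ 0)
    (hm : a * b - q l = -m) (hprim : IsPrimitiveVec (a, b, l)) :
    IsStandardizable B m (a, b, l) := by
  induction hN : a.natAbs using Nat.strong_induction_on generalizing m a b l with
  | _ N ih =>
  subst hN
  have hpos : ∀ {a' b' : ℤ} {l' : K}, a'.natAbs = a.natAbs → 0 < a' → a' * b' - q l' = -m →
      IsPrimitiveVec (a', b', l') → IsStandardizable B m (a', b', l') := by
    intro a' b' l' haa ha' hm' hprim'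
    rcases (show a' = 1 ∨ 2 ≤ a' by omega) with rfl | ha2
    · apply IsStandardizable.of_eichlerTransvection hs hq (-l')
      have hql : q (-l') = q l' := by simpa using quadratic_smul hq (-1) l'
      have h1 : b' + B l' (-l') + 1 * q (-l') = -m := by
        rw [map_neg, hq, hql]; linarith
      rw [h1, one_smul, add_neg_cancel]
      exact ⟨LinearMap.id, fun _ _ => rfl, rfl⟩
    · obtain ⟨k, u, hk, hQ0, hQa⟩ :=
        exists_small_value hs hq hdual (hpair m hm1) ha2 hm' hprim'
      have hk0 : k ≠ 0 := by
        rintro rfl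
        have := isCoprime_zero_left.1 hk
        rw [Int.isUnit_iff] at this
        omega
      apply IsStandardizable.of_scaling hk0 hk
      apply IsStandardizable.of_eichlerTransvection hs hq u
      apply IsStandardizable.of_swap
      have hQ : k ^ 2 * b' + B (k • l') u + a' * q u = b' * k ^ 2 + k * B l' u + a' * q u := by
        simp only [map_smul, LinearMap.smul_apply, smul_eq_mul]; ring
      rw [hQ]
      refine ih _ (by omega) ?_ hQ0.ne' ?_ ?_ rfl
      · have : 0 < k ^ 2 := by positivity
        nlinarith
      · rw [quadratic_add hs hq, quadratic_smul hq, quadratic_smul hq]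
        simp only [map_smul, LinearMap.smul_apply, smul_eq_mul]
        linear_combination k ^ 2 * hm'
      · rintro d hd1 hd2 ⟨x, hx⟩
        simp only at hd1 hd2 hx
        have hdk : IsCoprime d k := (hk.of_isCoprime_of_dvd_right hd2).symm
        obtain ⟨c, hc⟩ := hd2
        have hkl : k • l' = d • (x - c • u) := by
          rw [smul_sub, ← hx, smul_smul, ← hc, add_sub_cancel_right]
        have hl : ∃ z, l' = d • z := by
          obtain ⟨r, s, hrs⟩ := hdk
          refine ⟨r • l' + s • (x - c • u), ?_⟩
          rw [smul_add, smul_comm d s, ← hkl, smul_smul, smul_smul, ← add_smul, mul_comm d r,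
            hrs, one_smul]
        obtain ⟨z, hz⟩ := hl
        refine hprim' d ⟨c, hc⟩ ?_ ⟨z, hz⟩
        have h1 : d ∣ k * B l' u + a' * q u := by
          rw [hz, hc]
          simp only [map_smul, LinearMap.smul_apply, smul_eq_mul]
          exact ⟨k * B z u + c * q u, by ring⟩
        have h2 : d ∣ b' * k ^ 2 := by
          rw [add_assoc] at hd1
          exact (dvd_add_left h1).1 hd1
        exact (hdk.pow_right).dvd_of_dvd_mul_right h2
  rcases lt_or_gt_of_ne ha with hneg | h
  · apply IsStandardizable.of_neg
    refine hpos (by simp) (by omega) ?_ ?_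
    · have hql : q (-l) = q l := by simpa using quadratic_smul hq (-1) l
      rw [hql]; linarith
    · rintro d hd1 hd2 ⟨x, hx⟩
      exact hprim d ((dvd_neg).1 hd1) ((dvd_neg).1 hd2) ⟨-x, by
        rw [smul_neg, ← hx]; simp⟩
  · exact hpos rfl h hm hprim

/-- Every primitive vector of norm `-2m < 0` of `U ⊕ (-K)` can be mapped to `(1, -m, 0)`. -/
theorem isStandardizable_of_isPrimitiveVec [Module.IsTorsionFree ℤ K]
    (hs : ∀ x y, B x y = B y x) (hq : ∀ x, B x x = 2 * q x)
    (hdual : ∀ (d : ℤ) (x : K), (∀ y, d ∣ B x y) → ∃ z, x = d • z)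
    (hpair : ∀ m : ℤ, 1 ≤ m → HasSeparatedPair B q m)
    {m a b : ℤ} {l : K} (hm1 : 1 ≤ m)
    (hm : a * b - q l = -m) (hprim : IsPrimitiveVec (a, b, l)) :
    IsStandardizable B m (a, b, l) := by
  have main := @isStandardizable_of_ne_zero K _ B q _ hs hq hdual hpair
  by_cases ha : a = 0
  · subst ha
    apply IsStandardizable.of_swap
    by_cases hb : b = 0
    · subst hb
      obtain ⟨u, hu⟩ : ∃ u, B l u ≠ 0 := by
        by_contra! h
        have := hprim 0 dvd_rfl dvd_rfl (hdual 0 l fun y => by rw [h y])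
        simp at this
      apply IsStandardizable.of_swap
      apply IsStandardizable.of_eichlerTransvection hs hq u
      apply IsStandardizable.of_swap
      simp only [zero_mul, zero_add, add_zero, zero_smul]
      refine main hm1 hu (by linarith) ?_
      rintro d - - ⟨x, hx⟩
      exact hprim d (dvd_zero d) (dvd_zero d) ⟨x, hx⟩
    · refine main hm1 hb (by linarith) ?_
      rintro d hd1 hd2 hx
      exact hprim d hd2 hd1 hx
  · exact main hm1 ha hm hprim

end HyperbolicSum

section E8Sum

/-- The inverse of `E8Gram`, the Gram matrix of the fundamental weights of `E₈`. -/
def E8GramInv : Matrix (Fin 8) (Fin 8) ℤ :=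
  !![ 4,  5,  7, 10,  8,  6,  4,  2;
      5,  8, 10, 15, 12,  9,  6,  3;
      7, 10, 14, 20, 16, 12,  8,  4;
     10, 15, 20, 30, 24, 18, 12,  6;
      8, 12, 16, 24, 20, 15, 10,  5;
      6,  9, 12, 18, 15, 12,  8,  4;
      4,  6,  8, 12, 10,  8,  6,  3;
      2,  3,  4,  6,  5,  4,  3,  2]

lemma E8GramInv_mul_E8Gram : E8GramInv * E8Gram = 1 := by decide

lemma E8Gram_transpose : E8Gramᵀ = E8Gram := by decide

/-- The quadratic form `x ↦ ½ xᵀ E₈ x` of the root lattice `E₈`. -/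
def E8Quadratic (x : Fin 8 → ℤ) : ℤ :=
  ∑ i, x i ^ 2 - (x 0 * x 2 + x 1 * x 3 + x 2 * x 3 + x 3 * x 4 + x 4 * x 5 + x 5 * x 6
    + x 6 * x 7)

lemma dotProduct_E8Gram_mulVec (x y : Fin 8 → ℤ) :
    x ⬝ᵥ E8Gram *ᵥ y = 2 * ∑ i, x i * y i - (x 0 * y 2 + x 2 * y 0 + x 1 * y 3 + x 3 * y 1
      + x 2 * y 3 + x 3 * y 2 + x 3 * y 4 + x 4 * y 3 + x 4 * y 5 + x 5 * y 4 + x 5 * y 6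
      + x 6 * y 5 + x 6 * y 7 + x 7 * y 6) := by
  simp only [dotProduct, mulVec, E8Gram, Fin.sum_univ_eight, of_apply, cons_val]
  ring

/-- The bilinear form of `E₈ⁿ`. -/
def E8SumForm (n : ℕ) : (Fin n → Fin 8 → ℤ) →ₗ[ℤ] (Fin n → Fin 8 → ℤ) →ₗ[ℤ] ℤ :=
  LinearMap.mk₂ ℤ (fun x y => ∑ i, x i ⬝ᵥ E8Gram *ᵥ y i)
    (fun x y z => by simp [add_dotProduct, Finset.sum_add_distrib])
    (fun c x y => by simp only [Pi.smul_apply, smul_dotProduct, Finset.smul_sum])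
    (fun x y z => by simp [mulVec_add, dotProduct_add, Finset.sum_add_distrib])
    (fun c x y => by
      simp only [Pi.smul_apply, mulVec_smul, dotProduct_smul, Finset.smul_sum])

lemma E8SumForm_apply (n : ℕ) (x y : Fin n → Fin 8 → ℤ) :
    E8SumForm n x y = ∑ i, x i ⬝ᵥ E8Gram *ᵥ y i := rfl

lemma E8SumForm_comm (n : ℕ) (x y : Fin n → Fin 8 → ℤ) :
    E8SumForm n x y = E8SumForm n y x := by
  simp only [E8SumForm_apply]
  refine Finset.sum_congr rfl fun i _ => ?_
  rw [dotProduct_mulVec, ← mulVec_transpose, E8Gram_transpose, dotProduct_comm]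

lemma E8SumForm_self (n : ℕ) (x : Fin n → Fin 8 → ℤ) :
    E8SumForm n x x = 2 * ∑ i, E8Quadratic (x i) := by
  rw [E8SumForm_apply, Finset.mul_sum]
  refine Finset.sum_congr rfl fun i _ => ?_
  rw [dotProduct_E8Gram_mulVec, E8Quadratic]
  simp only [Fin.sum_univ_eight]
  ring

lemma E8SumForm_single (n : ℕ) (i : Fin n) (x : Fin n → Fin 8 → ℤ) (y : Fin 8 → ℤ) :
    E8SumForm n x (Pi.single i y) = x i ⬝ᵥ E8Gram *ᵥ y := by
  rw [E8SumForm_apply, Finset.sum_eq_single i]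
  · simp
  · intro j _ hj
    simp [Pi.single_eq_of_ne hj]
  · simp

lemma E8SumForm_dvd (n : ℕ) (d : ℤ) (x : Fin n → Fin 8 → ℤ)
    (h : ∀ y, d ∣ E8SumForm n x y) : ∃ z, x = d • z := by
  have hdvd : ∀ i j, d ∣ x i j := by
    intro i j
    have h1 := h (Pi.single i (E8GramInv *ᵥ Pi.single j 1))
    have h2 : E8Gram * E8GramInv = 1 := mul_eq_one_comm.1 E8GramInv_mul_E8Gram
    rw [E8SumForm_single, mulVec_mulVec, h2, one_mulVec] at h1
    simpa using h1
  choose z hz using hdvd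
  exact ⟨z, by ext i j; simpa using hz i j⟩

lemma exists_eq_sum_four_sq (m : ℤ) (hm : 1 ≤ m) :
    ∃ t a b c : ℤ, t ^ 2 - t + 1 + a ^ 2 + b ^ 2 + c ^ 2 = m := by
  have key : ∀ x y z w : ℤ, x ^ 2 + y ^ 2 + z ^ 2 + w ^ 2 = 4 * m - 3 → x % 2 = 1 →
      y % 2 = 0 → z % 2 = 0 → w % 2 = 0 →
      ∃ t a b c : ℤ, t ^ 2 - t + 1 + a ^ 2 + b ^ 2 + c ^ 2 = m := by
    intro x y z w h hx hy hz hw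
    obtain ⟨x, rfl⟩ : ∃ r, x = 2 * r - 1 := ⟨(x + 1) / 2, by omega⟩
    obtain ⟨y, rfl⟩ : ∃ r, y = 2 * r := ⟨y / 2, by omega⟩
    obtain ⟨z, rfl⟩ : ∃ r, z = 2 * r := ⟨z / 2, by omega⟩
    obtain ⟨w, rfl⟩ : ∃ r, w = 2 * r := ⟨w / 2, by omega⟩
    exact ⟨x, y, z, w, by linarith⟩
  have hmod : ∀ x : ℤ, x % 2 = 0 ∧ x ^ 2 % 4 = 0 ∨ x % 2 = 1 ∧ x ^ 2 % 4 = 1 := by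
    intro x
    rcases Int.even_or_odd' x with ⟨r, rfl | rfl⟩
    · left
      have : (2 * r) ^ 2 = 4 * r ^ 2 := by ring
      omega
    · right
      have : (2 * r + 1) ^ 2 = 4 * (r ^ 2 + r) + 1 := by ring
      omega
  obtain ⟨x, y, z, w, h⟩ := Nat.sum_four_squares (4 * m - 3).toNat
  have h' : (x : ℤ) ^ 2 + y ^ 2 + z ^ 2 + w ^ 2 = 4 * m - 3 := by
    have := congrArg (Nat.cast : ℕ → ℤ) h
    rw [Int.toNat_of_nonneg (by omega)] at this
    exact_mod_cast this
  rcases hmod x with ⟨h1, g1⟩ | ⟨h1, g1⟩ <;> rcases hmod y with ⟨h2, g2⟩ | ⟨h2, g2⟩ <;>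
    rcases hmod z with ⟨h3, g3⟩ | ⟨h3, g3⟩ <;> rcases hmod w with ⟨h4, g4⟩ | ⟨h4, g4⟩ <;>
    first
    | (exfalso; omega)
    | exact key x y z w h' h1 h2 h3 h4
    | exact key y x z w (by linarith) h2 h1 h3 h4
    | exact key z x y w (by linarith) h3 h1 h2 h4
    | exact key w x y z (by linarith) h4 h1 h2 h3

lemma E8Sum_hasSeparatedPair (n : ℕ) (hn : 1 ≤ n) (m : ℤ) (hm : 1 ≤ m) :
    HasSeparatedPair (E8SumForm n) (fun x => ∑ i, E8Quadratic (x i)) m := by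
  obtain ⟨t, a, b, c, h⟩ := exists_eq_sum_four_sq m hm
  have hsum : ∀ y : Fin 8 → ℤ, ∑ i : Fin n,
      E8Quadratic ((Pi.single ⟨0, hn⟩ y : Fin n → Fin 8 → ℤ) i) = E8Quadratic y := by
    intro y
    rw [Finset.sum_eq_single ⟨0, hn⟩]
    · simp
    · intro j _ hj
      simp [Pi.single_eq_of_ne hj, E8Quadratic]
    · simp
  refine ⟨Pi.single ⟨0, hn⟩ ![0, a, b, 0, c, 0, t, 1], Pi.single ⟨0, hn⟩ ![1, a, t, 0, b, 0, c, 0],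
    Pi.single ⟨0, hn⟩ (E8GramInv 7), Pi.single ⟨0, hn⟩ (E8GramInv 0), ?_, ?_, ?_, ?_, ?_⟩
  · refine (hsum _).trans ?_
    simp only [E8Quadratic, Fin.sum_univ_eight, cons_val]
    linear_combination h
  · refine (hsum _).trans ?_
    simp only [E8Quadratic, Fin.sum_univ_eight, cons_val]
    linear_combination h
  all_goals
    rw [E8SumForm_single, Pi.single_eq_same, dotProduct_E8Gram_mulVec]
    simp only [E8GramInv, Fin.sum_univ_eight, of_apply, cons_val]
    ring

/-- The coordinates of `ℤ^{8n+2}` adapted to the decomposition `U ⊕ (-E₈)ⁿ`. -/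
def IICoordinates (n : ℕ) :
    (Fin (8 * n + 2) → ℤ) ≃ₗ[ℤ] ℤ × ℤ × (Fin n → Fin 8 → ℤ) where
  toFun x := (x 0, x 1, fun i j => x ⟨8 * i + j + 2, by omega⟩)
  invFun p k := if (k : ℕ) = 0 then p.1 else if (k : ℕ) = 1 then p.2.1 else
    if h : ((k : ℕ) - 2) / 8 < n then p.2.2 ⟨_, h⟩ ⟨((k : ℕ) - 2) % 8, Nat.mod_lt _ (by norm_num)⟩
    else 0
  map_add' _ _ := rfl
  map_smul' _ _ := rfl
  left_inv x := by
    ext k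
    dsimp only
    split_ifs with h0 h1 h2
    · exact congrArg x (Fin.ext h0.symm)
    · exact congrArg x (Fin.ext (by simp [h1]))
    · exact congrArg x (Fin.ext (by simp only; omega))
    · omega
  right_inv p := by
    ext i j
    · simp
    · simp
    · have h1 : (8 * (i : ℕ) + j) / 8 = i := by omega
      have h2 : (j : ℕ) % 8 = j := by omega
      simp [h1, h2]

/-- Reindexing of the coordinates of `E₈ⁿ` by block and position within the block. -/
def blockEquiv (n : ℕ) : Fin n × Fin 8 ≃ Fin (8 * n) :=
  finProdFinEquiv.trans (finCongr (mul_comm n 8))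

lemma blockEquiv_val (n : ℕ) (p : Fin n × Fin 8) :
    (blockEquiv n p : ℕ) = 8 * p.1 + p.2 := by
  simp [blockEquiv, add_comm]

lemma IIGram_blockEquiv (n : ℕ) (p r : Fin n × Fin 8) :
    IIGram n (blockEquiv n p).succ.succ (blockEquiv n r).succ.succ =
      if p.1 = r.1 then -E8Gram p.2 r.2 else 0 := by
  have h1 : ∀ p : Fin n × Fin 8, (8 * (p.1 : ℕ) + p.2) / 8 = p.1 := fun p => by omega
  have h2 : ∀ p : Fin n × Fin 8, (8 * (p.1 : ℕ) + p.2) % 8 = p.2 := fun p => by omega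
  have h3 : ∀ k : ℕ, k + 1 + 1 - 2 = k := fun k => by omega
  have h4 : ∀ k : ℕ, k + 1 + 1 ≠ 0 ∧ k + 1 + 1 ≠ 1 ∧ 2 ≤ k + 1 + 1 := fun k => by omega
  simp only [IIGram, Fin.val_succ, blockEquiv_val, h1, h2, h3, h4, false_and, true_and,
    if_false, Fin.val_inj, Fin.eta]

lemma IIGram_zero_succ_succ (n : ℕ) (k : Fin (8 * n)) : IIGram n 0 k.succ.succ = 0 := by
  simp [IIGram]

lemma IIGram_one_succ_succ (n : ℕ) (k : Fin (8 * n)) :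
    IIGram n (Fin.succ 0) k.succ.succ = 0 := by
  simp [IIGram]

lemma IIGram_succ_succ_zero (n : ℕ) (k : Fin (8 * n)) : IIGram n k.succ.succ 0 = 0 := by
  simp [IIGram]

lemma IIGram_succ_succ_one (n : ℕ) (k : Fin (8 * n)) :
    IIGram n k.succ.succ (Fin.succ 0) = 0 := by
  simp [IIGram]

lemma dotProduct_IIGram_mulVec (n : ℕ) (x y : Fin (8 * n + 2) → ℤ) :
    x ⬝ᵥ IIGram n *ᵥ y =
      hyperbolicForm (E8SumForm n) (IICoordinates n x) (IICoordinates n y) := by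
  have hcx : ∀ p : Fin n × Fin 8,
      x (blockEquiv n p).succ.succ = (IICoordinates n x).2.2 p.1 p.2 := fun p =>
    congrArg x (Fin.ext (by simp [blockEquiv_val]))
  have hcy : ∀ p : Fin n × Fin 8,
      y (blockEquiv n p).succ.succ = (IICoordinates n y).2.2 p.1 p.2 := fun p =>
    congrArg y (Fin.ext (by simp [blockEquiv_val]))
  have h00 : IIGram n 0 0 = 0 := by simp [IIGram]
  have h01 : IIGram n 0 (Fin.succ 0) = 1 := by simp [IIGram]
  have h10 : IIGram n (Fin.succ 0) 0 = 1 := by simp [IIGram]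
  have h11 : IIGram n (Fin.succ 0) (Fin.succ 0) = 0 := by simp [IIGram]
  simp only [dotProduct, mulVec, Fin.sum_univ_succ (n := 8 * n + 1), Fin.sum_univ_succ (n := 8 * n),
    IIGram_zero_succ_succ, IIGram_one_succ_succ, IIGram_succ_succ_zero, IIGram_succ_succ_one,
    h00, h01, h10, h11, ← (blockEquiv n).sum_comp, IIGram_blockEquiv, hcx, hcy,
    Fintype.sum_prod_type, hyperbolicForm, E8SumForm_apply]
  have h0 : (IICoordinates n x).1 = x 0 ∧ (IICoordinates n y).1 = y 0 := ⟨rfl, rfl⟩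
  have h1 : (IICoordinates n x).2.1 = x (Fin.succ 0) ∧
    (IICoordinates n y).2.1 = y (Fin.succ 0) := ⟨rfl, rfl⟩
  simp [h0, h1, ite_mul, Finset.sum_ite_irrel, Finset.sum_ite_eq]
  ring

lemma IIGram_det_ne_zero (n : ℕ) : (IIGram n).det ≠ 0 := by
  intro hdet
  obtain ⟨x, hx, hx0⟩ := Matrix.exists_mulVec_eq_zero_iff.2 hdet
  have horth : ∀ p, hyperbolicForm (E8SumForm n) p (IICoordinates n x) = 0 := by
    intro p
    obtain ⟨y, rfl⟩ := (IICoordinates n).surjective p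
    rw [← dotProduct_IIGram_mulVec, hx0, dotProduct_zero]
  refine hx ((IICoordinates n).injective ?_)
  rw [map_zero]
  obtain ⟨z, hz⟩ := E8SumForm_dvd n 0 (IICoordinates n x).2.2 fun y => by
    have := horth (0, 0, y)
    rw [E8SumForm_comm]
    simpa [hyperbolicForm] using this
  refine Prod.ext ?_ (Prod.ext ?_ (by simpa using hz))
  · simpa [hyperbolicForm] using horth (0, 1, 0)
  · simpa [hyperbolicForm] using horth (1, 0, 0)

lemma exists_matrix_standardizing (n : ℕ) (hn : 1 ≤ n) (m : ℤ) (hm : 1 ≤ m)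
    (u : Fin (8 * n + 2) → ℤ) (hu : Finset.univ.gcd u = 1)
    (hnorm : u ⬝ᵥ IIGram n *ᵥ u = -(2 * m)) :
    ∃ M : Matrix (Fin (8 * n + 2)) (Fin (8 * n + 2)) ℤ, Mᵀ * IIGram n * M = IIGram n ∧
      M *ᵥ u = (IICoordinates n).symm (1, -m, 0) := by
  have hprim : IsPrimitiveVec (IICoordinates n u) := by
    rintro d ⟨a, ha⟩ ⟨b, hb⟩ ⟨x, hx⟩
    have hdu : u = d • (IICoordinates n).symm (a, b, x) := by
      rw [← map_smul, LinearEquiv.eq_symm_apply]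
      exact Prod.ext ha (Prod.ext hb hx)
    have hdvd : d ∣ Finset.univ.gcd u := Finset.dvd_gcd fun k _ => by
      rw [hdu]
      exact dvd_mul_right _ _
    exact isUnit_of_dvd_one (hu ▸ hdvd)
  rw [dotProduct_IIGram_mulVec, hyperbolicForm, E8SumForm_self] at hnorm
  obtain ⟨g, hg, hgu⟩ := isStandardizable_of_isPrimitiveVec (E8SumForm_comm n)
    (E8SumForm_self n) (E8SumForm_dvd n) (E8Sum_hasSeparatedPair n hn) hm
    (a := (IICoordinates n u).1) (b := (IICoordinates n u).2.1) (l := (IICoordinates n u).2.2)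
    (by linarith) hprim
  set f : (Fin (8 * n + 2) → ℤ) →ₗ[ℤ] (Fin (8 * n + 2) → ℤ) :=
    (IICoordinates n).symm.toLinearMap ∘ₗ g ∘ₗ (IICoordinates n).toLinearMap with hf
  have hfform : ∀ x y, f x ⬝ᵥ IIGram n *ᵥ f y = x ⬝ᵥ IIGram n *ᵥ y := by
    intro x y
    simp [dotProduct_IIGram_mulVec, hf, hg]
  refine ⟨LinearMap.toMatrix' f, ?_, ?_⟩
  · ext i j
    have h := hfform (Pi.single i 1) (Pi.single j 1)
    rw [← LinearMap.toMatrix'_mulVec, ← LinearMap.toMatrix'_mulVec f (Pi.single j 1),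
      ← vecMul_transpose, ← dotProduct_mulVec, mulVec_mulVec, mulVec_mulVec] at h
    simpa using h
  · rw [LinearMap.toMatrix'_mulVec]
    exact congrArg (IICoordinates n).symm hgu

end E8Sum

/-- For every `n ≥ 1` and `m ≥ 1`, the lattice `II_{1,8n+1}` has exactly one
orbit of primitive vectors of norm `-2m` under its automorphism group. -/
theorem II_single_orbit_primitive_negative_even_norm (n m : ℕ)
    (hn : 1 ≤ n) (hm : 1 ≤ m)
    (u v : Fin (8 * n + 2) → ℤ)
    (hu_prim : Finset.univ.gcd u = 1) (hv_prim : Finset.univ.gcd v = 1)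
    (hu_norm : u ⬝ᵥ (IIGram n).mulVec u = -(2 * (m : ℤ)))
    (hv_norm : v ⬝ᵥ (IIGram n).mulVec v = -(2 * (m : ℤ))) :
    ∃ M : Matrix (Fin (8 * n + 2)) (Fin (8 * n + 2)) ℤ,
      Mᵀ * IIGram n * M = IIGram n ∧ M.mulVec u = v := by
  have hm' : (1 : ℤ) ≤ m := by exact_mod_cast hm
  obtain ⟨A, hA, hAu⟩ := exists_matrix_standardizing n hn m hm' u hu_prim hu_norm
  obtain ⟨C, hC, hCv⟩ := exists_matrix_standardizing n hn m hm' v hv_prim hv_norm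
  have hdet : IsUnit C.det := by
    have h := congrArg Matrix.det hC
    rw [det_mul, det_mul, det_transpose, mul_right_comm, mul_left_eq_self₀] at h
    exact IsUnit.of_mul_eq_one _ (h.resolve_right (IIGram_det_ne_zero n))
  have hdetT : IsUnit Cᵀ.det := by rwa [det_transpose]
  refine ⟨C⁻¹ * A, ?_, ?_⟩
  · have h : (C⁻¹)ᵀ * IIGram n * C⁻¹ = IIGram n := by
      rw [transpose_nonsing_inv]
      nth_rewrite 1 [← hC]
      rw [Matrix.mul_assoc, Matrix.mul_assoc, Matrix.mul_assoc, mul_nonsing_inv _ hdet,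
        Matrix.mul_one, nonsing_inv_mul_cancel_left _ _ hdetT]
    calc (C⁻¹ * A)ᵀ * IIGram n * (C⁻¹ * A) = Aᵀ * ((C⁻¹)ᵀ * IIGram n * C⁻¹) * A := by
          simp only [transpose_mul, Matrix.mul_assoc]
      _ = IIGram n := by rw [h, hA]
  · rw [← mulVec_mulVec, hAu, ← hCv, mulVec_mulVec, nonsing_inv_mul _ hdet, one_mulVec]
end

section
/- Let n ≥ 3 and let m be an integer with 1 ≤ m < n and m ≡ n − 1 (mod 8). Then the lattice I_{1,n} has exactly one orbit of primitive characteristic vectors of norm −m under its automorphism group: for any two vectors u, v ∈ ℤ^{n+1} that are both primitive, characteristic, and satisfy ⟪u,u⟫ = ⟪v,v⟫ = −m, there exists an integer matrix M with Mᵀ Ω M = Ω and M u = v. -/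
open Matrix

theorem exists_isCoprime_of_forall_prime {F : ℤ → ℤ} (hF : ∀ s t, s - t ∣ F s - F t) {c : ℕ}
    (hc : c ≠ 0) (h : ∀ p : ℕ, p.Prime → p ∣ c → ∃ t, ¬ (p : ℤ) ∣ F t) :
    ∃ t, IsCoprime (F t) (c : ℤ) := by
  induction c using Nat.recOnPosPrimePosCoprime with
  | zero => exact absurd rfl hc
  | one => exact ⟨0, by simp [isCoprime_one_right]⟩
  | prime_pow p k hp hk =>
    obtain ⟨t, ht⟩ := h p hp (dvd_pow_self p hk.ne')
    refine ⟨t, ?_⟩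
    push_cast
    exact (((Nat.prime_iff_prime_int.mp hp).coprime_iff_not_dvd.mpr ht).symm).pow_right
  | coprime x y hx hy hxy ihx ihy =>
    obtain ⟨s, hs⟩ := ihx (by omega) fun p hp hd => h p hp (hd.mul_right y)
    obtain ⟨t, ht⟩ := ihy (by omega) fun p hp hd => h p hp (hd.mul_left x)
    obtain ⟨i, j, hij⟩ := Nat.isCoprime_iff_coprime.mpr hxy
    have key : ∀ r s z : ℤ, z ∣ r - s → IsCoprime (F s) z → IsCoprime (F r) z := by
      intro r s z hz hs
      obtain ⟨w, hw⟩ := hz.trans (hF r s)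
      have : F r = F s + z * w := by linarith
      rw [this]
      exact hs.add_mul_left_left w
    refine ⟨s * (j * y) + t * (i * x), ?_⟩
    push_cast
    refine IsCoprime.mul_right (key _ s _ ⟨i * (t - s), ?_⟩ hs) (key _ t _ ⟨j * (s - t), ?_⟩ ht)
    · linear_combination s * hij
    · linear_combination t * hij

theorem exists_isCoprime_of_forall_prime_int {F : ℤ → ℤ} (hF : ∀ s t, s - t ∣ F s - F t) {c : ℤ}
    (hc : c ≠ 0) (h : ∀ p : ℕ, p.Prime → (p : ℤ) ∣ c → ∃ t, ¬ (p : ℤ) ∣ F t) :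
    ∃ t, IsCoprime (F t) c := by
  obtain ⟨t, ht⟩ := exists_isCoprime_of_forall_prime hF (Int.natAbs_ne_zero.mpr hc)
    fun p hp hd => h p hp (Int.natCast_dvd.mpr hd)
  exact ⟨t, ht.of_isCoprime_of_dvd_right (Int.dvd_natAbs.mpr dvd_rfl)⟩

section Bilinear

variable {L : Type*} [AddCommGroup L]

/-- Some linear endomorphism preserving the norm of `B` maps `u` to `v`. -/
def CarriesTo (B : LinearMap.BilinForm ℤ L) (u v : L) : Prop :=
  ∃ g : L →ₗ[ℤ] L, (∀ x, B (g x) (g x) = B x x) ∧ g u = v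

theorem CarriesTo.trans {B : LinearMap.BilinForm ℤ L} {u v w : L}
    (h₁ : CarriesTo B u v) (h₂ : CarriesTo B v w) : CarriesTo B u w := by
  obtain ⟨g, hg, rfl⟩ := h₁
  obtain ⟨k, hk, rfl⟩ := h₂
  exact ⟨k ∘ₗ g, fun x => by simp [hk, hg], rfl⟩

/-- The Eichler transvection attached to an isotropic vector `f` and a vector `κ` of even norm
orthogonal to `f`. -/
theorem carriesTo_transvection {B : LinearMap.BilinForm ℤ L} (hB : ∀ x y, B x y = B y x)
    {f κ : L} {q : ℤ} (hff : B f f = 0) (hfκ : B f κ = 0) (hκ : B κ κ = 2 * q) (u : L) :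
    CarriesTo B u (u + B f u • κ - B κ u • f - (q * B f u) • f) := by
  refine ⟨LinearMap.id + (B f).smulRight κ - (B κ).smulRight f - (q • B f).smulRight f,
    fun x => ?_, ?_⟩
  · simp only [LinearMap.add_apply, LinearMap.sub_apply, LinearMap.id_apply,
      LinearMap.smulRight_apply, LinearMap.smul_apply, map_add, map_sub, map_smul, smul_eq_mul,
      hB κ f, hB x f, hB x κ, hff, hfκ, hκ]
    ring
  · simp

/-- The reflection in a vector of norm `-1`. -/
theorem carriesTo_reflection {B : LinearMap.BilinForm ℤ L} (hB : ∀ x y, B x y = B y x)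
    {ε : L} (hε : B ε ε = -1) (u : L) : CarriesTo B u (u + (2 * B ε u) • ε) := by
  refine ⟨LinearMap.id + (2 • B ε).smulRight ε, fun x => ?_, ?_⟩
  · simp only [LinearMap.add_apply, LinearMap.id_apply,
      LinearMap.smulRight_apply, LinearMap.smul_apply, map_add, map_smul, smul_eq_mul,
      hB x ε, hε, nsmul_eq_mul]
    push_cast
    ring
  · simp

/-- The rational reflection exchanging `u₀` and `u₀ + 2d`, composed with the rational isometry
`e ↦ D e`, `f ↦ D⁻¹ f`, is integral when `d = a e + D b f + D ν`. -/
theorem carriesTo_of_divisible {B : LinearMap.BilinForm ℤ L} (hB : ∀ x y, B x y = B y x)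
    {u₀ e f ν : L} {a b D : ℤ} (hee : B e e = 0) (hff : B f f = 0) (hef : B e f = 1)
    (hue : B e u₀ = 0) (huf : B f u₀ = 0) (hνe : B e ν = 0) (hνf : B f ν = 0)
    (hνu : B ν u₀ = -1) (hD : 2 * a * b + D * B ν ν = 1) :
    CarriesTo B (u₀ + (2 : ℤ) • (a • e + (D * b) • f + D • ν)) u₀ := by
  refine ⟨LinearMap.id + ((D - 1) • B f).smulRight e - (B e).smulRight f
    + (B e).smulRight ((B ν ν) • f - (2 * a ^ 2) • e - (2 * a) • ν)
    - ((2 * b) • B f + (2 : ℤ) • B ν).smulRight ((a * D) • e + b • f + D • ν), fun x => ?_, ?_⟩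
  · simp only [LinearMap.add_apply, LinearMap.sub_apply, LinearMap.id_apply,
      LinearMap.smulRight_apply, LinearMap.smul_apply, map_add, map_sub, map_smul, smul_eq_mul,
      hB f e, hB x e, hB x f, hB x ν, hB ν e, hB ν f, hee, hff, hef, hνe, hνf]
    generalize B x x = X at *
    generalize B e x = q at *
    generalize B f x = p at *
    generalize B ν x = s at *
    generalize B ν ν = N at *
    linear_combination (2 * p * q + 4 * a * q * (b * p + s) + 4 * (b * p + s) ^ 2 * D) * hD
  · simp only [LinearMap.add_apply, LinearMap.sub_apply, LinearMap.id_apply,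
      LinearMap.smulRight_apply, LinearMap.smul_apply, map_add, map_smul, smul_eq_mul,
      hB f e, hB ν e, hB ν f, hee, hff, hef, hνe, hνf, hue, huf, hνu]
    generalize B ν ν = N at *
    match_scalars
    · ring
    · linear_combination (-4 * a * D) * hD
    · linear_combination (-2 * b) * hD
    · linear_combination (-4 * D) * hD

/-- Auxiliary vectors around a vector `u₀`: a hyperbolic pair `e, f` and a root `κ` orthogonal to
`u₀` and to each other, and a vector `ε` of norm `-1` pairing to `-1` with `u₀`. -/
structure IsFrame (B : LinearMap.BilinForm ℤ L) (u₀ e f κ ε : L) : Prop where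
  ee : B e e = 0
  ff : B f f = 0
  ef : B e f = 1
  eu : B e u₀ = 0
  fu : B f u₀ = 0
  κκ : B κ κ = -2
  eκ : B e κ = 0
  fκ : B f κ = 0
  κu : B κ u₀ = 0
  εε : B ε ε = -1
  εu : B ε u₀ = -1

theorem IsFrame.carriesTo_of_isCoprime {B : LinearMap.BilinForm ℤ L}
    (hB : ∀ x y, B x y = B y x) {u₀ e f κ ε d : L} (hF : IsFrame B u₀ e f κ ε)
    (hchar : ∀ x, (2 : ℤ) ∣ B x x - B u₀ x) (hd : B u₀ d = -B d d) (hodd : ¬ (2 : ℤ) ∣ B d d)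
    (hcop : IsCoprime (B f d) (B d d)) : CarriesTo B (u₀ + (2 : ℤ) • d) u₀ := by
  have hcop' := hcop
  obtain ⟨r, s, hrs⟩ := hcop
  obtain ⟨ee, ff, ef, eu, fu, -, -, -, -, εε, εu⟩ := hF
  set a := B f d with ha
  set b := B e d with hb
  set D := B d d with hD
  have hD0 : D ≠ 0 := by rintro h; simp [h] at hodd
  obtain ⟨δ, hδ⟩ : ∃ δ, δ = d - a • e - b • f := ⟨_, rfl⟩
  obtain ⟨ν₁, hν₁⟩ : ∃ ν₁, ν₁ = -ε + B f ε • e + B e ε • f := ⟨_, rfl⟩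
  have eδ : B e δ = 0 := by simp [hδ, ee, ef, ← hb]
  have fδ : B f δ = 0 := by simp [hδ, ff, hB f e, ef, ← ha]
  have uδ : B u₀ δ = -D := by simp [hδ, hB u₀ e, hB u₀ f, eu, fu, hd]
  have eν₁ : B e ν₁ = 0 := by simp [hν₁, ee, ef]
  have fν₁ : B f ν₁ = 0 := by simp [hν₁, ff, hB f e, ef]
  have uν₁ : B u₀ ν₁ = 1 := by simp [hν₁, hB u₀ e, hB u₀ f, hB u₀ ε, eu, fu, εu]
  obtain ⟨k, hk⟩ : ∃ k, k = r • δ + (D * r) • ν₁ := ⟨_, rfl⟩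
  obtain ⟨ν, hν⟩ : ∃ ν, ν = s • δ - (a * r) • ν₁ := ⟨_, rfl⟩
  have ek : B e k = 0 := by simp [hk, eδ, eν₁]
  have fk : B f k = 0 := by simp [hk, fδ, fν₁]
  have uk : B u₀ k = 0 := by simp [hk, uδ, uν₁]; ring
  have eν : B e ν = 0 := by simp [hν, eδ, eν₁]
  have fν : B f ν = 0 := by simp [hν, fδ, fν₁]
  have νu : B ν u₀ = -1 := by
    rw [hB]; simp [hν, uδ, uν₁]; linear_combination -hrs
  have hDν : D • ν = δ - a • k := by
    rw [hν, hk]; match_scalars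
    · linear_combination hrs
    all_goals ring
  obtain ⟨q, hq⟩ := hchar k
  rw [uk, sub_zero] at hq
  obtain ⟨b', hb'⟩ : ∃ b', b' = b + B k d - q * a := ⟨_, rfl⟩
  have hdec : d = a • e + b • f + δ := by rw [hδ]; module
  have hkd : B k d = B k δ := by
    rw [hdec]; simp [hB k e, hB k f, ek, fk]
  have hDδ : D = 2 * a * b + B δ δ := by
    rw [hD, hdec]; simp [hB f e, hB δ e, hB δ f, ee, ff, ef, eδ, fδ]; ring
  have hνν : D * (D * B ν ν) = B δ δ - 2 * a * B k δ + 2 * a ^ 2 * q := by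
    have : B (D • ν) (D • ν) = B (δ - a • k) (δ - a • k) := by rw [hDν]
    simp [hB δ k, hq] at this
    linear_combination this
  have hsum : D = 2 * a * b' + D * (D * B ν ν) := by
    rw [hνν, hb', hkd]; linear_combination hDδ
  have hdvd : D ∣ 2 * a * b' := ⟨1 - D * B ν ν, by linear_combination -hsum⟩
  have h2 : IsCoprime D 2 := ((Int.prime_two.coprime_iff_not_dvd).mpr hodd).symm
  obtain ⟨b₁, hb₁⟩ := (h2.mul_right hcop'.symm).dvd_of_dvd_mul_left hdvd
  have hone : 2 * a * b₁ + D * B ν ν = 1 := by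
    apply mul_left_cancel₀ hD0
    rw [hb₁] at hsum
    linear_combination -hsum
  have h1 := carriesTo_transvection hB (f := f) (κ := -k) (q := q) ff (by simp [fk])
    (by simp [hq]) (u₀ + (2 : ℤ) • d)
  refine h1.trans ?_
  have hend := carriesTo_of_divisible hB ee ff ef eu fu eν fν νu hone
  convert hend using 1
  rw [hDν, ← hb₁, hb', hδ]
  simp only [map_add, map_neg, map_smul, LinearMap.neg_apply, fu, hB k u₀, uk, ← ha, smul_eq_mul]
  module

theorem norm_of_norm_eq {B : LinearMap.BilinForm ℤ L} (hB : ∀ x y, B x y = B y x) {u₀ d : L}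
    (h : B (u₀ + (2 : ℤ) • d) (u₀ + (2 : ℤ) • d) = B u₀ u₀) : B u₀ d = -B d d := by
  simp [hB d u₀] at h
  linarith

theorem CarriesTo.norm_eq {B : LinearMap.BilinForm ℤ L} {u v : L} (h : CarriesTo B u v) :
    B v v = B u u := by
  obtain ⟨g, hg, rfl⟩ := h
  exact hg u

theorem IsFrame.carriesTo_of_forall_prime {B : LinearMap.BilinForm ℤ L}
    (hB : ∀ x y, B x y = B y x) {u₀ e f κ ε d : L} (hF : IsFrame B u₀ e f κ ε)
    (hchar : ∀ x, (2 : ℤ) ∣ B x x - B u₀ x)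
    (hn : B (u₀ + (2 : ℤ) • d) (u₀ + (2 : ℤ) • d) = B u₀ u₀) (hodd : ¬ (2 : ℤ) ∣ B u₀ d)
    (hp : ∀ p : ℕ, p.Prime → (p : ℤ) ∣ B u₀ d → (p : ℤ) ∣ B f d → ¬ (p : ℤ) ∣ B e d) :
    CarriesTo B (u₀ + (2 : ℤ) • d) u₀ := by
  have hD0 : B u₀ d ≠ 0 := by rintro h; simp [h] at hodd
  obtain ⟨t, ht⟩ := exists_isCoprime_of_forall_prime_int
    (F := fun t => B f d - t * B κ d + t ^ 2 * B e d)
    (fun s t => ⟨-B κ d + (s + t) * B e d, by ring⟩) hD0 (fun p pp hpD => by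
      by_cases ha : (p : ℤ) ∣ B f d
      · have hb := hp p pp hpD ha
        by_contra! hall
        obtain ⟨i, hi⟩ := hall 1
        obtain ⟨j, hj⟩ := hall (-1)
        obtain ⟨k, hk⟩ := ha
        have h1 : (p : ℤ) ∣ 2 * B e d :=
          ⟨i + j - 2 * k, by linear_combination hi + hj - 2 * hk⟩
        rcases (Nat.prime_iff_prime_int.mp pp).dvd_or_dvd h1 with h2 | h2
        · have : p = 2 := (Nat.prime_dvd_prime_iff_eq pp Nat.prime_two).mp (by exact_mod_cast h2)
          subst this
          exact hodd (by exact_mod_cast hpD)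
        · exact hb h2
      · exact ⟨0, by simpa using ha⟩)
  have h1 := carriesTo_transvection hB (f := e) (κ := t • κ) (q := -t ^ 2) hF.ee
    (by simp [hF.eκ]) (by simp [hF.κκ]; ring) (u₀ + (2 : ℤ) • d)
  obtain ⟨d', hd'⟩ : ∃ d', d' = d + (t * B e d) • κ - (t * B κ d) • e + (t ^ 2 * B e d) • e :=
    ⟨_, rfl⟩
  have hu' : u₀ + (2 : ℤ) • d + B e (u₀ + (2 : ℤ) • d) • t • κ
      - B (t • κ) (u₀ + (2 : ℤ) • d) • e - (-t ^ 2 * B e (u₀ + (2 : ℤ) • d)) • e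
      = u₀ + (2 : ℤ) • d' := by
    rw [hd']
    simp only [map_add, map_smul, LinearMap.smul_apply, hF.eu, hF.κu, smul_eq_mul]
    module
  rw [hu'] at h1
  refine h1.trans ?_
  have hn' := norm_of_norm_eq hB (h1.norm_eq.trans hn)
  have hud : B u₀ d' = B u₀ d := by
    simp [hd', hB u₀ κ, hB u₀ e, hF.eu, hF.κu]
  have hfd : B f d' = B f d - t * B κ d + t ^ 2 * B e d := by
    simp [hd', hF.fκ, hB f e, hF.ef]
  have hdd : B d' d' = -B u₀ d := by rw [← hud, hn', neg_neg]
  refine hF.carriesTo_of_isCoprime hB hchar hn' ?_ ?_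
  · rwa [hdd, dvd_neg]
  · rw [hdd, hfd]
    exact ht.neg_right

theorem IsFrame.carriesTo_of_odd {B : LinearMap.BilinForm ℤ L}
    (hB : ∀ x y, B x y = B y x) {u₀ e f κ ε d : L} (hF : IsFrame B u₀ e f κ ε)
    (hchar : ∀ x, (2 : ℤ) ∣ B x x - B u₀ x)
    (hn : B (u₀ + (2 : ℤ) • d) (u₀ + (2 : ℤ) • d) = B u₀ u₀) (hodd : ¬ (2 : ℤ) ∣ B u₀ d)
    (hprim : ∃ x, B x (u₀ + (2 : ℤ) • d) = 1) :
    CarriesTo B (u₀ + (2 : ℤ) • d) u₀ := by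
  have hD0 : B u₀ d ≠ 0 := by rintro h; simp [h] at hodd
  obtain ⟨x, hx⟩ := hprim
  obtain ⟨κ₁, hκ₁⟩ : ∃ κ₁, κ₁ = x - B f x • e := ⟨_, rfl⟩
  have hfκ₁ : B f κ₁ = 0 := by simp [hκ₁, hB f e, hF.ef]
  obtain ⟨g, hg⟩ : ∃ g, g = B κ₁ (u₀ + (2 : ℤ) • d) := ⟨_, rfl⟩
  have hgb : g = 1 - 2 * B f x * B e d := by
    rw [hg, hκ₁, map_sub, LinearMap.sub_apply, hx]
    simp [hF.eu]
    ring
  obtain ⟨t, ht⟩ := exists_isCoprime_of_forall_prime_int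
    (F := fun t => B e d - t * g) (fun s t => ⟨-g, by ring⟩) hD0 (fun p pp _ => by
      by_contra! hall
      have hb : (p : ℤ) ∣ B e d := by simpa using hall 0
      have h1 : (p : ℤ) ∣ g := by
        have := dvd_sub hb (hall 1)
        simpa using this
      have : (p : ℤ) ∣ 1 := by
        have := dvd_add h1 (hb.mul_left (2 * B f x))
        rw [hgb] at this
        simpa using this
      exact (Nat.prime_iff_prime_int.mp pp).not_dvd_one this)
  have h1 := carriesTo_transvection hB (f := f) (κ := (2 * t) • κ₁)
    (q := 2 * t ^ 2 * B κ₁ κ₁) hF.ff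
    (by simp [hfκ₁]) (by simp; ring) (u₀ + (2 : ℤ) • d)
  obtain ⟨d', hd'⟩ : ∃ d', d' = d + (2 * t * B f d) • κ₁ - (t * g) • f
      - (2 * t ^ 2 * B κ₁ κ₁ * B f d) • f := ⟨_, rfl⟩
  have hu' : u₀ + (2 : ℤ) • d + B f (u₀ + (2 : ℤ) • d) • (2 * t) • κ₁
      - B ((2 * t) • κ₁) (u₀ + (2 : ℤ) • d) • f
      - (2 * t ^ 2 * B κ₁ κ₁ * B f (u₀ + (2 : ℤ) • d)) • f
      = u₀ + (2 : ℤ) • d' := by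
    rw [map_smul, LinearMap.smul_apply, ← hg, hd']
    simp only [map_add, map_smul, hF.fu, smul_eq_mul]
    module
  rw [hu'] at h1
  refine h1.trans ?_
  have hud : B u₀ d' = B u₀ d + 2 * (t * B f d * B u₀ κ₁) := by
    simp [hd', hB u₀ f, hF.fu]
    ring
  have hfd : B f d' = B f d := by
    simp [hd', hfκ₁, hF.ff]
  have hed : B e d' = (B e d - t * g) + B f d * (2 * t * B e κ₁ - 2 * t ^ 2 * B κ₁ κ₁) := by
    simp [hd', hF.ef]
    ring
  refine hF.carriesTo_of_forall_prime hB hchar (h1.norm_eq.trans hn) ?_ ?_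
  · rw [hud]
    omega
  · intro p pp hpu hpf hpe
    rw [hfd] at hpf
    have hpD : (p : ℤ) ∣ B u₀ d := by
      rw [hud] at hpu
      exact (dvd_add_left ⟨2 * (B f d / p * t * B u₀ κ₁), by
        obtain ⟨c, hc⟩ := hpf
        rw [hc, Int.mul_ediv_cancel_left _ (by exact_mod_cast pp.ne_zero)]
        ring⟩).mp hpu
    have hpF : (p : ℤ) ∣ B e d - t * g := by
      rw [hed] at hpe
      exact (dvd_add_left (hpf.mul_right _)).mp hpe
    exact (Nat.prime_iff_prime_int.mp pp).not_isUnit (ht.isUnit_of_dvd' hpF hpD)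

/-- A frame around a characteristic vector `u₀` moves every vector congruent to `u₀` modulo `2`, of
the same norm and pairing to `1` with some vector, onto `u₀`. -/
theorem IsFrame.carriesTo {B : LinearMap.BilinForm ℤ L}
    (hB : ∀ x y, B x y = B y x) {u₀ e f κ ε d : L} (hF : IsFrame B u₀ e f κ ε)
    (hchar : ∀ x, (2 : ℤ) ∣ B x x - B u₀ x)
    (hn : B (u₀ + (2 : ℤ) • d) (u₀ + (2 : ℤ) • d) = B u₀ u₀)
    (hprim : ∃ x, B x (u₀ + (2 : ℤ) • d) = 1) :
    CarriesTo B (u₀ + (2 : ℤ) • d) u₀ := by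
  by_cases hodd : (2 : ℤ) ∣ B u₀ d
  · have h1 := carriesTo_reflection hB hF.εε (u₀ + (2 : ℤ) • d)
    have hu' : u₀ + (2 : ℤ) • d + (2 * B ε (u₀ + (2 : ℤ) • d)) • ε
        = u₀ + (2 : ℤ) • (d + B ε (u₀ + (2 : ℤ) • d) • ε) := by module
    obtain ⟨x, hx⟩ := hprim
    have hx' : B (x + (2 * B ε x) • ε) (u₀ + (2 : ℤ) • d + (2 * B ε (u₀ + (2 : ℤ) • d)) • ε)
        = 1 := by
      generalize u₀ + (2 : ℤ) • d = u at *
      simp [hF.εε, hB x ε, hx]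
      ring
    rw [hu'] at h1 hx'
    refine h1.trans (hF.carriesTo_of_odd hB hchar (h1.norm_eq.trans hn) ?_ ⟨_, hx'⟩)
    simp [hB u₀ ε, hF.εu]
    omega
  · exact hF.carriesTo_of_odd hB hchar hn hodd hprim

end Bilinear

/-- The Lorentzian form of signature `(1, n)` evaluated on integer sequences. -/
def seqForm (n : ℕ) (x y : ℕ → ℤ) : ℤ :=
  x 0 * y 0 - ∑ i ∈ Finset.range n, x (i + 1) * y (i + 1)

/-- The isometric embedding of `I_{1,n}` into `I_{1,n+8}` orthogonal to a copy of `E₈`. -/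
def seqShift (x : ℕ → ℤ) : ℕ → ℤ :=
  fun i => if i = 0 then 3 * x 0 else if i ≤ 8 then x 0 else x (i - 8)

theorem seqForm_add_eight (n : ℕ) (x y : ℕ → ℤ) :
    seqForm (n + 8) x y = x 0 * y 0 - (x 1 * y 1 + x 2 * y 2 + x 3 * y 3 + x 4 * y 4 + x 5 * y 5
      + x 6 * y 6 + x 7 * y 7 + x 8 * y 8) - ∑ i ∈ Finset.range n, x (i + 9) * y (i + 9) := by
  simp only [seqForm, Finset.sum_range_succ', add_assoc, Nat.reduceAdd, zero_add]
  ring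

theorem seqForm_seqShift (n : ℕ) (x y : ℕ → ℤ) :
    seqForm (n + 8) (seqShift x) (seqShift y) = seqForm n x y := by
  have h : ∀ i : ℕ, ¬ i + 9 ≤ 8 := by omega
  have h' : ∀ i : ℕ, i + 9 - 8 = i + 1 := by omega
  rw [seqForm_add_eight]
  simp [seqShift, h, h', seqForm]
  ring

/-- The conditions of `IsFrame` for sequences, without the root `κ`, together with the parity and
the norm of `u₀`. -/
structure IsSeqFrame (n m : ℕ) (u₀ e f ε : ℕ → ℤ) : Prop where
  odd : ∀ i, ¬ (2 : ℤ) ∣ u₀ i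
  uu : seqForm n u₀ u₀ = -m
  ee : seqForm n e e = 0
  ff : seqForm n f f = 0
  ef : seqForm n e f = 1
  eu : seqForm n e u₀ = 0
  fu : seqForm n f u₀ = 0
  εε : seqForm n ε ε = -1
  εu : seqForm n ε u₀ = -1

/-- A root orthogonal to `u₀`, `e` and `f`. -/
structure IsSeqRoot (n : ℕ) (u₀ e f κ : ℕ → ℤ) : Prop where
  κκ : seqForm n κ κ = -2
  eκ : seqForm n e κ = 0
  fκ : seqForm n f κ = 0
  κu : seqForm n κ u₀ = 0

theorem IsSeqFrame.shift {n m : ℕ} {u₀ e f ε : ℕ → ℤ} (h : IsSeqFrame n m u₀ e f ε) :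
    IsSeqFrame (n + 8) m (seqShift u₀) (seqShift e) (seqShift f) (seqShift ε) := by
  refine ⟨fun i => ?_, ?_, ?_, ?_, ?_, ?_, ?_, ?_, ?_⟩
  · have h0 := h.odd 0
    have hi := h.odd (i - 8)
    unfold seqShift
    split_ifs <;> omega
  all_goals rw [seqForm_seqShift]
  exacts [h.uu, h.ee, h.ff, h.ef, h.eu, h.fu, h.εε, h.εu]

theorem isSeqRoot_shift (n : ℕ) (u₀ e f : ℕ → ℤ) :
    IsSeqRoot (n + 8) (seqShift u₀) (seqShift e) (seqShift f)
      (fun i => if i = 1 then 1 else if i = 2 then -1 else 0) := by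
  constructor <;> simp [seqForm_add_eight, seqShift]

theorem isSeqFrame_base (m : ℕ) :
    IsSeqFrame (m + 2) (m + 1) (fun _ => 1) (fun i => if i ≤ 1 then 1 else 0)
      (fun i => if i = 0 ∨ i = 2 then 1 else 0) (fun i => if i = 1 then 1 else 0) := by
  constructor
  case uu => simp [seqForm]; ring
  case odd => simp
  all_goals simp [seqForm, Finset.sum_range_succ']

theorem isSeqRoot_base (m : ℕ) :
    IsSeqRoot (m + 3) (fun _ => 1) (fun i => if i ≤ 1 then 1 else 0)
      (fun i => if i = 0 ∨ i = 2 then 1 else 0)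
      (fun i => if i ≤ 2 then 1 else if i = 3 then -1 else 0) := by
  constructor <;> simp [seqForm, Finset.sum_range_succ']

theorem exists_isSeqFrame (m k : ℕ) :
    ∃ u₀ e f ε, IsSeqFrame (m + 2 + 8 * k) (m + 1) u₀ e f ε := by
  induction k with
  | zero => exact ⟨_, _, _, _, isSeqFrame_base m⟩
  | succ k ih =>
    obtain ⟨u₀, e, f, ε, h⟩ := ih
    exact ⟨_, _, _, _, h.shift⟩

theorem exists_isSeqFrame_isSeqRoot {n m : ℕ} (hn : 3 ≤ n) (hm1 : 1 ≤ m) (hmn : m < n)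
    (hmod : m ≡ n - 1 [MOD 8]) :
    ∃ u₀ e f κ ε, IsSeqFrame n m u₀ e f ε ∧ IsSeqRoot n u₀ e f κ := by
  obtain ⟨m, rfl⟩ := Nat.exists_eq_add_of_le' hm1
  obtain ⟨k, hk⟩ : ∃ k, n = m + 2 + 8 * k := ⟨(n - (m + 2)) / 8, by
    unfold Nat.ModEq at hmod
    omega⟩
  obtain _ | k := k
  · obtain ⟨m, rfl⟩ : ∃ j, m = j + 1 := ⟨m - 1, by omega⟩
    subst hk
    exact ⟨_, _, _, _, _, isSeqFrame_base (m + 1), isSeqRoot_base m⟩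
  · obtain ⟨u₀, e, f, ε, h⟩ := exists_isSeqFrame m k
    subst hk
    exact ⟨_, _, _, _, _, h.shift, isSeqRoot_shift _ u₀ e f⟩

theorem formI_seq (n : ℕ) (x y : ℕ → ℤ) :
    formI n (fun i => x i) (fun i => y i) = seqForm n x y := by
  simp [formI_eq, seqForm, Finset.sum_range]

theorem formI_comm (n : ℕ) (u v : Fin (n + 1) → ℤ) : formI n u v = formI n v u := by
  simp [formI_eq, mul_comm]

theorem odd_of_characteristicI {n : ℕ} {v : Fin (n + 1) → ℤ} (hv : CharacteristicI n v)
    (i : Fin (n + 1)) : ¬ (2 : ℤ) ∣ v i := by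
  have h := hv (Pi.single i 1)
  simp only [formI, OmegaI, mulVec_single_one, dotProduct, col_apply, diagonal_apply] at h
  simp [Pi.single_apply] at h
  intro h2
  split_ifs at h <;> simp [Int.ModEq] at h <;> omega

theorem two_dvd_formI_self_sub {n : ℕ} {u : Fin (n + 1) → ℤ} (hu : ∀ i, ¬ (2 : ℤ) ∣ u i)
    (x : Fin (n + 1) → ℤ) : (2 : ℤ) ∣ formI n x x - formI n u x := by
  have key : ∀ i, (2 : ℤ) ∣ x i * x i - u i * x i := fun i => by
    rw [← sub_mul]
    rcases Int.emod_two_eq_zero_or_one (x i) with h | h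
    · exact (Int.dvd_of_emod_eq_zero h).mul_left _
    · exact Dvd.dvd.mul_right (by have := hu i; omega) _
  have : formI n x x - formI n u x = (x 0 * x 0 - u 0 * x 0)
      - ∑ i : Fin n, (x i.succ * x i.succ - u i.succ * x i.succ) := by
    rw [formI_eq, formI_eq, Finset.sum_sub_distrib]
    ring
  rw [this]
  exact dvd_sub (key 0) (Finset.dvd_sum fun i _ => key _)

theorem exists_formI_eq_one {n : ℕ} {u : Fin (n + 1) → ℤ} (hu : PrimitiveI n u) :
    ∃ x, formI n x u = 1 := by
  have h1 : (1 : ℤ) ∈ Ideal.span (Set.range u) := by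
    obtain ⟨g, hg⟩ := IsPrincipalIdealRing.principal (Ideal.span (Set.range u))
    have hdvd : g ∣ Finset.univ.gcd u := Finset.dvd_gcd fun i _ => by
      have : u i ∈ Ideal.span (Set.range u) := Ideal.subset_span ⟨i, rfl⟩
      rw [hg] at this
      exact Ideal.mem_span_singleton.mp this
    rw [hu] at hdvd
    rw [hg]
    exact Ideal.mem_span_singleton.mpr hdvd
  obtain ⟨c, hc⟩ := Ideal.mem_span_range_iff_exists_fun.mp h1
  refine ⟨OmegaI n *ᵥ c, ?_⟩
  rw [formI_comm, formI, mulVec_mulVec, OmegaI_mul_self, one_mulVec, dotProduct, ← hc]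
  exact Finset.sum_congr rfl fun i _ => mul_comm _ _

theorem exists_matrix_of_carriesTo {n : ℕ} {u v : Fin (n + 1) → ℤ}
    (h : CarriesTo (Matrix.toBilin' (OmegaI n)) u v) :
    ∃ M : Matrix (Fin (n + 1)) (Fin (n + 1)) ℤ,
      Mᵀ * OmegaI n * M = OmegaI n ∧ M.mulVec u = v := by
  obtain ⟨g, hg, rfl⟩ := h
  have hform : ∀ x y, Matrix.toBilin' (OmegaI n) x y = formI n x y :=
    fun x y => Matrix.toBilin'_apply' _ _ _
  have hpol : ∀ x y, formI n (g x) (g y) = formI n x y := by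
    intro x y
    have hx := hg x
    have hy := hg y
    have hxy := hg (x + y)
    simp only [map_add, LinearMap.add_apply, hform, formI_comm n y x, formI_comm n (g y) (g x)]
      at hx hy hxy
    linarith
  refine ⟨LinearMap.toMatrix' g, ?_, by simp⟩
  apply Matrix.toBilin'.injective
  refine LinearMap.ext fun x => LinearMap.ext fun y => ?_
  rw [hform, ← hpol, Matrix.toBilin'_apply', formI, ← mulVec_mulVec, ← mulVec_mulVec,
    mulVec_transpose, dotProduct_comm, ← dotProduct_mulVec, dotProduct_comm]
  simp

/-- For `n ≥ 3` and `1 ≤ m < n` with `m ≡ n - 1 (mod 8)`, the lattice `I_{1,n}`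
has exactly one orbit of primitive characteristic vectors of norm `-m` under
its automorphism group. -/
theorem single_orbit_primitive_characteristic_negative_norm (n m : ℕ)
    (hn : 3 ≤ n) (hm1 : 1 ≤ m) (hmn : m < n) (hmod : m ≡ n - 1 [MOD 8])
    (u v : Fin (n + 1) → ℤ)
    (hu_prim : PrimitiveI n u) (hv_prim : PrimitiveI n v)
    (hu_char : CharacteristicI n u) (hv_char : CharacteristicI n v)
    (hu_norm : formI n u u = -(m : ℤ)) (hv_norm : formI n v v = -(m : ℤ)) :
    ∃ M : Matrix (Fin (n + 1)) (Fin (n + 1)) ℤ,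
      Mᵀ * OmegaI n * M = OmegaI n ∧ M.mulVec u = v := by
  obtain ⟨u₀, e, f, κ, ε, hF, hR⟩ := exists_isSeqFrame_isSeqRoot hn hm1 hmn hmod
  have hform : ∀ x y, Matrix.toBilin' (OmegaI n) x y = formI n x y :=
    fun x y => Matrix.toBilin'_apply' _ _ _
  have hB : ∀ x y, Matrix.toBilin' (OmegaI n) x y = Matrix.toBilin' (OmegaI n) y x :=
    fun x y => by rw [hform, hform, formI_comm]
  have hframe : IsFrame (Matrix.toBilin' (OmegaI n)) (fun i => u₀ i) (fun i => e i) (fun i => f i)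
      (fun i => κ i) (fun i => ε i) := by
    constructor <;> rw [hform, formI_seq]
    exacts [hF.ee, hF.ff, hF.ef, hF.eu, hF.fu, hR.κκ, hR.eκ, hR.fκ, hR.κu, hF.εε, hF.εu]
  have key : ∀ w : Fin (n + 1) → ℤ, PrimitiveI n w → CharacteristicI n w →
      formI n w w = -(m : ℤ) → ∃ M : Matrix (Fin (n + 1)) (Fin (n + 1)) ℤ,
      Mᵀ * OmegaI n * M = OmegaI n ∧ M.mulVec w = fun i : Fin (n + 1) => u₀ i := by
    intro w hprim hchar hnorm
    have hw : w = (fun i : Fin (n + 1) => u₀ i)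
        + (2 : ℤ) • (fun i : Fin (n + 1) => (w i - u₀ i) / 2) := by
      ext i
      have h1 := odd_of_characteristicI hchar i
      have h2 := hF.odd i
      simp only [Pi.add_apply, Pi.smul_apply, smul_eq_mul]
      omega
    apply exists_matrix_of_carriesTo
    obtain ⟨x, hx⟩ := exists_formI_eq_one hprim
    rw [hw]
    refine hframe.carriesTo hB (fun x => ?_) ?_ ⟨x, ?_⟩
    · rw [hform, hform]
      exact two_dvd_formI_self_sub (fun i => hF.odd i) x
    · rw [← hw, hform, hform, hnorm, formI_seq, hF.uu]
    · rw [← hw, hform, hx]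
  obtain ⟨M, hM, hMu⟩ := key u hu_prim hu_char hu_norm
  obtain ⟨N, hN, hNv⟩ := key v hv_prim hv_char hv_norm
  have hleft : (OmegaI n * Nᵀ * OmegaI n) * N = 1 := by
    rw [Matrix.mul_assoc, Matrix.mul_assoc, ← Matrix.mul_assoc Nᵀ, hN, OmegaI_mul_self]
  have hright : N * (OmegaI n * Nᵀ * OmegaI n) = 1 := mul_eq_one_comm.mp hleft
  refine ⟨OmegaI n * Nᵀ * OmegaI n * M, ?_, ?_⟩
  · have hW : (OmegaI n * Nᵀ * OmegaI n)ᵀ * OmegaI n * (OmegaI n * Nᵀ * OmegaI n) = OmegaI n := by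
      have hT : (OmegaI n)ᵀ = OmegaI n := diagonal_transpose _
      rw [transpose_mul, transpose_mul, transpose_transpose, hT, Matrix.mul_assoc (OmegaI n),
        Matrix.mul_assoc (OmegaI n), Matrix.mul_assoc (N * OmegaI n), ← Matrix.mul_assoc (OmegaI n)
        (OmegaI n * Nᵀ), ← Matrix.mul_assoc (OmegaI n) (OmegaI n), OmegaI_mul_self,
        Matrix.one_mul, Matrix.mul_assoc N, ← Matrix.mul_assoc (OmegaI n) Nᵀ, hright,
        Matrix.mul_one]
    rw [transpose_mul, Matrix.mul_assoc, Matrix.mul_assoc, ← Matrix.mul_assoc (OmegaI n) _ M,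
      ← Matrix.mul_assoc _ (OmegaI n * _) M,
      ← Matrix.mul_assoc _ (OmegaI n) (OmegaI n * Nᵀ * OmegaI n), hW, ← Matrix.mul_assoc, hM]
  · rw [← Matrix.mulVec_mulVec, hMu, ← hNv, Matrix.mulVec_mulVec, hleft, Matrix.one_mulVec]
end

section
/- For every n ≥ 2, every primitive characteristic vector of norm 9 − n in I_{1,n} lies in the automorphism orbit of (3, 1, 1, …, 1): if v ∈ ℤ^{n+1} is primitive and characteristic with ⟪v,v⟫ = 9 − n, then there exists an integer matrix M with Mᵀ Ω M = Ω such that M v = (3, 1, …, 1). -/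
open Matrix

/-- The Lorentzian form of signature `(1, n)` as a bilinear form over an arbitrary ring. -/
def lorentzForm (R : Type*) [CommRing R] (n : ℕ) : LinearMap.BilinForm R (Fin (n + 1) → R) :=
  Matrix.toBilin' (Matrix.diagonal fun i => if i = 0 then 1 else -1)

lemma lorentzForm_apply {R : Type*} [CommRing R] {n : ℕ} (u v : Fin (n + 1) → R) :
    lorentzForm R n u v = ∑ i, (if i = 0 then 1 else -1) * (u i * v i) := by
  simp only [lorentzForm, Matrix.toBilin'_apply, Matrix.diagonal_apply]
  refine Finset.sum_congr rfl fun i _ => ?_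
  rw [Finset.sum_eq_single i]
  · simp
  · intro j _ hj
    simp [hj.symm]
  · simp

lemma lorentzForm_apply_succ {R : Type*} [CommRing R] {n : ℕ} (u v : Fin (n + 1) → R) :
    lorentzForm R n u v = u 0 * v 0 - ∑ i : Fin n, u i.succ * v i.succ := by
  rw [lorentzForm_apply, Fin.sum_univ_succ]
  simp [Fin.succ_ne_zero, sub_eq_add_neg]

lemma lorentzForm_comm {R : Type*} [CommRing R] {n : ℕ} (u v : Fin (n + 1) → R) :
    lorentzForm R n u v = lorentzForm R n v u := by
  simp only [lorentzForm_apply, mul_comm]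

lemma lorentzForm_single {R : Type*} [CommRing R] {n : ℕ} (u : Fin (n + 1) → R)
    (i : Fin (n + 1)) :
    lorentzForm R n u (Pi.single i 1) = (if i = 0 then 1 else -1) * u i := by
  rw [lorentzForm_apply, Finset.sum_eq_single i]
  · simp
  · intro j _ hj
    simp [hj]
  · simp

lemma lorentzForm_snoc {R : Type*} [CommRing R] {n : ℕ} (u v : Fin (n + 1) → R) (a b : R) :
    lorentzForm R (n + 1) (Fin.snoc u a : Fin (n + 2) → R) (Fin.snoc v b : Fin (n + 2) → R) =
      lorentzForm R n u v - a * b := by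
  rw [lorentzForm_apply, lorentzForm_apply, Fin.sum_univ_castSucc]
  simp [sub_eq_add_neg]

/-- The inclusion of integer vectors in rational vectors. -/
def ratVec {n : ℕ} (u : Fin (n + 1) → ℤ) : Fin (n + 1) → ℚ := fun i => (u i : ℚ)

lemma lorentzForm_ratVec {n : ℕ} (u v : Fin (n + 1) → ℤ) :
    lorentzForm ℚ n (ratVec u) (ratVec v) = (lorentzForm ℤ n u v : ℚ) := by
  simp only [lorentzForm_apply, ratVec]
  push_cast
  rfl

lemma ratVec_smul {n : ℕ} (c : ℤ) (u : Fin (n + 1) → ℤ) :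
    ratVec (c • u) = (c : ℚ) • ratVec u := by
  ext i
  simp [ratVec]

lemma exists_lorentzForm_eq_one_of_gcd {n : ℕ} {v : Fin (n + 1) → ℤ}
    (h : Finset.univ.gcd v = 1) : ∃ w, lorentzForm ℤ n w v = 1 := by
  obtain ⟨g, hg⟩ := Finset.gcd_eq_sum_mul Finset.univ v
  refine ⟨fun i => (if i = 0 then 1 else -1) * g i, ?_⟩
  rw [lorentzForm_apply]
  refine Eq.trans ?_ (hg.symm.trans h)
  refine Finset.sum_congr rfl fun i _ => ?_
  split_ifs <;> ring

lemma exists_eq_smul_primitive {n : ℕ} {u : Fin (n + 1) → ℤ} (hu : u ≠ 0) :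
    ∃ d : ℤ, 0 < d ∧ ∃ m : Fin (n + 1) → ℤ, u = d • m ∧ ∃ w, lorentzForm ℤ n w m = 1 := by
  obtain ⟨m, hm, h1⟩ := Finset.extract_gcd u (s := Finset.univ) Finset.univ_nonempty
  refine ⟨Finset.univ.gcd u, ?_, m, ?_, exists_lorentzForm_eq_one_of_gcd h1⟩
  · refine lt_of_le_of_ne ?_ ?_
    · rw [← Finset.normalize_gcd (s := Finset.univ) (f := u)]
      exact Int.nonneg_of_normalize_eq_self (normalize_idem _)
    · intro h0
      apply hu
      ext i
      rw [hm i (Finset.mem_univ _), ← h0]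
      simp
  · ext i
    simpa using hm i (Finset.mem_univ _)

lemma exists_primitive_ratVec_eq_smul {n : ℕ} {q : Fin (n + 1) → ℚ} (hq : q ≠ 0) :
    ∃ (c : ℚ) (z : Fin (n + 1) → ℤ), c ≠ 0 ∧ ratVec z = c • q ∧
      ∃ y, lorentzForm ℤ n y z = 1 := by
  obtain ⟨⟨b, hb⟩, h⟩ := IsLocalization.exist_integer_multiples_of_finite
    (nonZeroDivisors ℤ) (S := ℚ) q
  choose u hu using h
  have hb0 : (b : ℚ) ≠ 0 := by exact_mod_cast nonZeroDivisors.ne_zero hb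
  have hu' : ratVec u = (b : ℚ) • q := by
    ext i
    have := hu i
    simpa [ratVec] using this
  have hu0 : u ≠ 0 := by
    rintro rfl
    have : (b : ℚ) • q = 0 := by
      rw [← hu']
      ext i
      simp [ratVec]
    exact (smul_ne_zero hb0 hq) this
  obtain ⟨d, hd, z, rfl, hy⟩ := exists_eq_smul_primitive hu0
  have hd0 : (d : ℚ) ≠ 0 := by exact_mod_cast hd.ne'
  refine ⟨(d : ℚ)⁻¹ * b, z, mul_ne_zero (inv_ne_zero hd0) hb0, ?_, hy⟩
  rw [mul_smul, ← hu', ratVec_smul, smul_smul, inv_mul_cancel₀ hd0, one_smul]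

/-- A family of vectors whose Gram matrix is `diag (1, -1, …, -1)`. -/
def IsLorentzFamily {R : Type*} [CommRing R] {n : ℕ} (a : Fin (n + 1) → Fin (n + 1) → R) : Prop :=
  ∀ i j, lorentzForm R n (a i) (a j) = if i = j then (if i = 0 then 1 else -1) else 0

lemma isLorentzFamily_single (R : Type*) [CommRing R] (n : ℕ) :
    IsLorentzFamily (R := R) (n := n) fun i => Pi.single i 1 := by
  intro i j
  rw [lorentzForm_single]
  by_cases h : i = j
  · subst h
    simp
  · simp [h, Ne.symm h]

/-- Witt's theorem for one vector of norm `-1`: a Lorentz family can be changed so that it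
contains a given vector of norm `-1`, keeping the members orthogonal to that vector. -/
lemma IsLorentzFamily.exists_replace {n : ℕ} {a : Fin (n + 1) → Fin (n + 1) → ℚ}
    (ha : IsLorentzFamily a) {j : Fin (n + 1)} (hj : j ≠ 0) {f : Fin (n + 1) → ℚ}
    (hf : lorentzForm ℚ n f f = -1) :
    ∃ a', IsLorentzFamily a' ∧ a' j = f ∧
      ∀ i, i ≠ j → lorentzForm ℚ n f (a i) = 0 → a' i = a i := by
  have hjj := ha j j
  simp only [if_true, if_neg hj] at hjj
  set t := lorentzForm ℚ n f (a j) with ht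
  have ht' : lorentzForm ℚ n (a j) f = t := lorentzForm_comm _ _
  obtain ⟨ε, hε, hne⟩ : ∃ ε : ℚ, ε * ε = 1 ∧ t + ε ≠ 0 := by
    by_cases h : t = -1
    · exact ⟨-1, by norm_num, by rw [h]; norm_num⟩
    · exact ⟨1, by norm_num, fun h' => h (by linarith)⟩
  have hε0 : ε ≠ 0 := by
    rintro rfl
    norm_num at hε
  set r := f - ε • a j with hr
  have hrr : lorentzForm ℚ n r r = -2 * ε * (t + ε) := by
    simp only [hr, map_sub, map_smul, LinearMap.sub_apply, LinearMap.smul_apply, smul_eq_mul,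
      hf, hjj, ← ht, ht']
    linear_combination hε
  have hrr0 : lorentzForm ℚ n r r ≠ 0 := by
    rw [hrr]
    exact mul_ne_zero (mul_ne_zero (by norm_num) hε0) hne
  let s : (Fin (n + 1) → ℚ) → (Fin (n + 1) → ℚ) := fun x =>
    x - (2 * lorentzForm ℚ n x r / lorentzForm ℚ n r r) • r
  have hs : ∀ x y, lorentzForm ℚ n (s x) (s y) = lorentzForm ℚ n x y := by
    intro x y
    simp only [s, map_sub, map_smul, LinearMap.sub_apply, LinearMap.smul_apply, smul_eq_mul,
      lorentzForm_comm r y]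
    field_simp
    ring
  have hsj : ε • s (a j) = f := by
    have h1 : 2 * lorentzForm ℚ n (a j) r / lorentzForm ℚ n r r = -ε := by
      rw [div_eq_iff hrr0, hrr]
      simp only [hr, map_sub, map_smul, smul_eq_mul, hjj, ht']
      linear_combination (-2 * (t + ε)) * hε
    change ε • (a j - (2 * lorentzForm ℚ n (a j) r / lorentzForm ℚ n r r) • r) = f
    rw [h1, hr]
    ext i
    simp only [Pi.smul_apply, Pi.sub_apply, smul_eq_mul]
    linear_combination (f i - ε * a j i) * hε
  refine ⟨fun i => (if i = j then ε else 1) • s (a i), ?_, by simpa using hsj, ?_⟩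
  · intro i k
    simp only [map_smul, LinearMap.smul_apply, smul_eq_mul, hs, ha i k]
    by_cases h : i = k
    · subst h
      by_cases h' : i = j
      · simp only [h', if_true]
        rw [← mul_assoc, hε, one_mul]
      · simp [h']
    · simp [h]
  · intro i hij hi
    have : lorentzForm ℚ n (a i) r = 0 := by
      simp [hr, lorentzForm_comm (a i) f, hi, ha i j, hij]
    simp [hij, s, this]

lemma exists_norm_one_norm_neg_one {n : ℕ} {y z : Fin (n + 1) → ℤ} {k : ℤ}
    (hz : lorentzForm ℤ n z z = 0) (hyz : lorentzForm ℤ n y z = 1)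
    (hy : lorentzForm ℤ n y y = 2 * k + 1) :
    lorentzForm ℤ n (y - k • z) (y - k • z) = 1 ∧
      lorentzForm ℤ n (y - k • z - z) (y - k • z - z) = -1 ∧
      lorentzForm ℤ n (y - k • z - z) (y - k • z) = 0 := by
  have hzy : lorentzForm ℤ n z y = 1 := by rw [lorentzForm_comm, hyz]
  refine ⟨?_, ?_, ?_⟩ <;>
  · simp only [map_sub, map_smul, LinearMap.sub_apply, LinearMap.smul_apply, smul_eq_mul, hz, hyz,
      hzy, hy]
    ring

/-- The orthogonal complement of integral members of a Lorentz family which contains a vector of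
norm `1` and an isotropic vector also contains an orthogonal pair of integral vectors of norms
`1` and `-1`. -/
lemma exists_integral_family_step {n : ℕ} {a : Fin (n + 1) → Fin (n + 1) → ℚ}
    (ha : IsLorentzFamily a) {j : Fin (n + 1)} (hj : j ≠ 0)
    {w : Fin (n + 1) → Fin (n + 1) → ℤ} (hw : ∀ i, j < i → a i = ratVec (w i))
    {p : Fin (n + 1) → ℤ} (hp : lorentzForm ℤ n p p = 1)
    (hpw : ∀ i, j < i → lorentzForm ℤ n p (w i) = 0) :
    ∃ e q, lorentzForm ℤ n e e = -1 ∧ lorentzForm ℤ n q q = 1 ∧ lorentzForm ℤ n q e = 0 ∧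
      (∀ i, j < i → lorentzForm ℤ n e (w i) = 0) ∧
      (∀ i, j < i → lorentzForm ℤ n q (w i) = 0) := by
  have hne : a 0 + a j ≠ 0 := by
    intro h
    have : lorentzForm ℚ n (a 0) (a 0 + a j) = 0 := by rw [h, map_zero]
    rw [map_add, ha, ha, if_pos rfl, if_pos rfl, if_neg hj.symm] at this
    norm_num at this
  obtain ⟨c, z, -, hz, y₀, hy₀⟩ := exists_primitive_ratVec_eq_smul hne
  have hzz : lorentzForm ℤ n z z = 0 := by
    have : lorentzForm ℚ n (ratVec z) (ratVec z) = 0 := by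
      simp [hz, ha _ _, hj, hj.symm]
    rw [lorentzForm_ratVec] at this
    exact_mod_cast this
  have hzw : ∀ i, j < i → lorentzForm ℤ n z (w i) = 0 := by
    intro i hi
    have h0 : i ≠ 0 := (lt_of_le_of_lt (Fin.zero_le j) hi).ne'
    have : lorentzForm ℚ n (ratVec z) (ratVec (w i)) = 0 := by
      simp [hz, ← hw i hi, ha _ _, hi.ne, h0.symm]
    rw [lorentzForm_ratVec] at this
    exact_mod_cast this
  have hww : ∀ i k, j < i → j < k → lorentzForm ℤ n (w i) (w k) = if i = k then -1 else 0 := by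
    intro i k hi hk
    have h0 : i ≠ 0 := (lt_of_le_of_lt (Fin.zero_le j) hi).ne'
    have := ha i k
    rw [hw i hi, hw k hk, lorentzForm_ratVec, if_neg h0] at this
    split_ifs at this ⊢ <;> exact_mod_cast this
  obtain ⟨y, hyz, hyw⟩ : ∃ y, lorentzForm ℤ n y z = 1 ∧
      ∀ i, j < i → lorentzForm ℤ n y (w i) = 0 := by
    refine ⟨y₀ + ∑ i ∈ Finset.univ.filter (j < ·), lorentzForm ℤ n y₀ (w i) • w i, ?_, ?_⟩
    · rw [map_add, LinearMap.add_apply, hy₀, map_sum, LinearMap.sum_apply, Finset.sum_eq_zero,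
        add_zero]
      intro i hi
      rw [map_smul, LinearMap.smul_apply, lorentzForm_comm (w i), hzw i (Finset.mem_filter.1 hi).2,
        smul_zero]
    · intro k hk
      rw [map_add, LinearMap.add_apply, map_sum, LinearMap.sum_apply, Finset.sum_eq_single k]
      · simp [hww k k hk hk, -zsmul_eq_mul]
      · intro i hi hik
        simp [hww i k (Finset.mem_filter.1 hi).2 hk, hik, -zsmul_eq_mul]
      · intro h
        exact absurd (Finset.mem_filter.2 ⟨Finset.mem_univ _, hk⟩) h
  obtain ⟨x, hxz, hxw, k, hxx⟩ : ∃ x, lorentzForm ℤ n x z = 1 ∧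
      (∀ i, j < i → lorentzForm ℤ n x (w i) = 0) ∧ ∃ k, lorentzForm ℤ n x x = 2 * k + 1 := by
    rcases Int.even_or_odd' (lorentzForm ℤ n y y) with ⟨k, hk | hk⟩
    · set t := lorentzForm ℤ n p z with ht
      set r := lorentzForm ℤ n p y with hr
      have hr' : lorentzForm ℤ n y p = r := lorentzForm_comm _ _
      refine ⟨y + (p - t • y), ?_, ?_, r - t * r + k + t ^ 2 * k - 2 * t * k, ?_⟩
      · simp [hyz, ← ht, -zsmul_eq_mul]
      · intro i hi
        simp [hyw i hi, hpw i hi, -zsmul_eq_mul]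
      · simp only [map_add, map_sub, map_smul, LinearMap.add_apply, LinearMap.sub_apply,
          LinearMap.smul_apply, smul_eq_mul, hp, ← hr, hr', hk]
        ring
    · exact ⟨y, hyz, hyw, k, hk⟩
  obtain ⟨h1, h2, h3⟩ := exists_norm_one_norm_neg_one hzz hxz hxx
  refine ⟨x - k • z - z, x - k • z, h2, h1, by rw [lorentzForm_comm, h3], ?_, ?_⟩ <;>
  · intro i hi
    simp [hxw i hi, hzw i hi, -zsmul_eq_mul]

/-- Orthogonal integral vectors `e` and `p` of norms `-1` and `1` give an integral Lorentz
family containing `e`. -/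
lemma exists_integral_family {n : ℕ} (hn : n ≠ 0) {e p : Fin (n + 1) → ℤ}
    (he : lorentzForm ℤ n e e = -1) (hp : lorentzForm ℤ n p p = 1)
    (hpe : lorentzForm ℤ n p e = 0) :
    ∃ b : Fin (n + 1) → Fin (n + 1) → ℤ, IsLorentzFamily b ∧ b (Fin.last n) = e := by
  have key : ∀ m : ℕ, m < n → ∃ (a : Fin (n + 1) → Fin (n + 1) → ℚ)
      (w : Fin (n + 1) → Fin (n + 1) → ℤ) (q : Fin (n + 1) → ℤ), IsLorentzFamily a ∧
      (∀ i, n - 1 - m < i.val → a i = ratVec (w i)) ∧ w (Fin.last n) = e ∧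
      lorentzForm ℤ n q q = 1 ∧ ∀ i, n - 1 - m < i.val → lorentzForm ℤ n q (w i) = 0 := by
    intro m
    induction m with
    | zero =>
      intro _
      obtain ⟨a, ha, hae, -⟩ := (isLorentzFamily_single ℚ n).exists_replace
        (j := Fin.last n) (f := ratVec e) (by simpa [Fin.ext_iff] using hn)
        (by rw [lorentzForm_ratVec, he]; norm_num)
      have hlast : ∀ i : Fin (n + 1), n - 1 - 0 < i.val → i = Fin.last n := by
        intro i hi
        ext
        simp only [Fin.val_last]
        omega
      refine ⟨a, fun _ => e, p, ha, ?_, rfl, hp, fun _ _ => hpe⟩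
      intro i hi
      rw [hlast i hi, hae]
    | succ m ih =>
      intro hm
      obtain ⟨a, w, q, ha, hw, hwe, hq, hqw⟩ := ih (by omega)
      let j : Fin (n + 1) := ⟨n - 1 - m, by omega⟩
      have hj : j ≠ 0 := by
        intro h
        have := congrArg Fin.val h
        simp only [j, Fin.val_zero] at this
        omega
      obtain ⟨f, q', hf, hq', hqf, hfw, hqw'⟩ := exists_integral_family_step ha hj
        (w := w) (fun i hi => hw i hi) hq (fun i hi => hqw i hi)
      obtain ⟨a', ha', haj, hai⟩ := ha.exists_replace hj (f := ratVec f)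
        (by rw [lorentzForm_ratVec, hf]; norm_num)
      have hcase : ∀ i : Fin (n + 1), n - 1 - (m + 1) < i.val → i ≠ j → j < i := by
        intro i hi hij
        have : i.val ≠ n - 1 - m := fun h => hij (Fin.ext h)
        change n - 1 - m < i.val
        omega
      refine ⟨a', Function.update w j f, q', ha', ?_, ?_, hq', ?_⟩
      · intro i hi
        by_cases hij : i = j
        · subst hij
          rw [haj, Function.update_self]
        · have hlt := hcase i hi hij
          rw [Function.update_of_ne hij, ← hw i hlt]
          refine hai i hij ?_
          rw [hw i hlt, lorentzForm_ratVec, hfw i hlt]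
          norm_num
      · have : Fin.last n ≠ j := by
          intro h
          have := congrArg Fin.val h
          simp only [j, Fin.val_last] at this
          omega
        rw [Function.update_of_ne this, hwe]
      · intro i hi
        by_cases hij : i = j
        · subst hij
          rw [Function.update_self, hqf]
        · rw [Function.update_of_ne hij]
          exact hqw' i (hcase i hi hij)
  obtain ⟨a, w, q, ha, hw, hwe, hq, hqw⟩ := key (n - 1) (by omega)
  have hpos : ∀ i : Fin (n + 1), i ≠ 0 → n - 1 - (n - 1) < i.val := by
    intro i hi
    have : i.val ≠ 0 := fun h => hi (Fin.ext h)
    omega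
  refine ⟨Function.update w 0 q, ?_, ?_⟩
  · intro i j
    by_cases hi : i = 0
    · subst hi
      by_cases hj : j = 0
      · subst hj
        simp [hq]
      · simp [Function.update_of_ne hj, hqw j (hpos j hj), Ne.symm hj]
    · by_cases hj : j = 0
      · subst hj
        simp [lorentzForm_comm _ q, hqw i (hpos i hi), hi]
      · rw [Function.update_of_ne hi, Function.update_of_ne hj]
        have := ha i j
        rw [hw i (hpos i hi), hw j (hpos j hj), lorentzForm_ratVec] at this
        split_ifs at this ⊢ <;> exact_mod_cast this
  · rw [Function.update_of_ne (by simpa [Fin.ext_iff] using hn), hwe]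

/-- A vector of norm `-1` which is orthogonal to a vector of norm `1` can be moved to the last
basis vector by an automorphism. -/
lemma exists_equiv_last {n : ℕ} (hn : n ≠ 0) {e p : Fin (n + 1) → ℤ}
    (he : lorentzForm ℤ n e e = -1) (hp : lorentzForm ℤ n p p = 1)
    (hpe : lorentzForm ℤ n p e = 0) :
    ∃ g : (Fin (n + 1) → ℤ) ≃ₗ[ℤ] (Fin (n + 1) → ℤ),
      (∀ x y, lorentzForm ℤ n (g x) (g y) = lorentzForm ℤ n x y) ∧
        g e = Pi.single (Fin.last n) 1 := by
  obtain ⟨b, hb, hbe⟩ := exists_integral_family hn he hp hpe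
  let D : Matrix (Fin (n + 1)) (Fin (n + 1)) ℤ := Matrix.diagonal fun i => if i = 0 then 1 else -1
  let B : Matrix (Fin (n + 1)) (Fin (n + 1)) ℤ := Matrix.of b
  have hD : D * D = 1 := by
    rw [Matrix.diagonal_mul_diagonal, ← Matrix.diagonal_one]
    congr 1
    ext i
    split_ifs <;> rfl
  have hBD : B * D * Bᵀ = D := by
    ext i j
    change _ = Matrix.diagonal (fun i => if i = 0 then 1 else -1) i j
    rw [Matrix.diagonal_apply, ← hb i j, lorentzForm_apply, Matrix.mul_apply]
    refine Finset.sum_congr rfl fun k _ => ?_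
    rw [Matrix.mul_diagonal]
    simp only [B, Matrix.of_apply, Matrix.transpose_apply]
    ring
  have h1 : (D * B * D) * Bᵀ = 1 := by
    rw [Matrix.mul_assoc D, Matrix.mul_assoc D, hBD, hD]
  have h2 : Bᵀ * (D * B * D) = 1 := mul_eq_one_comm.1 h1
  let g := Matrix.toLin'OfInv h2 h1
  have hg : ∀ x y, lorentzForm ℤ n (g.symm x) (g.symm y) = lorentzForm ℤ n x y := by
    intro x y
    change lorentzForm ℤ n (Bᵀ *ᵥ x) (Bᵀ *ᵥ y) = _
    simp only [lorentzForm, Matrix.toBilin'_apply']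
    change Bᵀ *ᵥ x ⬝ᵥ D *ᵥ Bᵀ *ᵥ y = x ⬝ᵥ D *ᵥ y
    conv_rhs => rw [← hBD]
    rw [Matrix.mulVec_transpose, Matrix.mulVec_transpose, ← Matrix.mulVec_mulVec,
      ← Matrix.mulVec_mulVec, Matrix.dotProduct_mulVec x, Matrix.mulVec_transpose]
  refine ⟨g, fun x y => by simpa using (hg (g x) (g y)).symm, ?_⟩
  rw [← LinearEquiv.eq_symm_apply, ← hbe]
  change _ = Bᵀ *ᵥ Pi.single (Fin.last n) 1
  rw [Matrix.mulVec_single_one]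
  rfl

lemma exists_isotropic_orthogonal {n : ℕ} (hn : 5 ≤ n) {v : Fin (n + 1) → ℤ}
    (hv : lorentzForm ℤ n v v < 0) :
    ∃ z, lorentzForm ℤ n z z = 0 ∧ lorentzForm ℤ n z v = 0 ∧ ∃ y, lorentzForm ℤ n y z = 1 := by
  obtain ⟨a, b, c, d, hN⟩ : ∃ a b c d : ℤ,
      lorentzForm ℤ n v v = -(a ^ 2 + b ^ 2 + c ^ 2 + d ^ 2) := by
    obtain ⟨a, b, c, d, habcd⟩ := Nat.sum_four_squares (lorentzForm ℤ n v v).natAbs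
    have : (((lorentzForm ℤ n v v).natAbs : ℕ) : ℤ) = -lorentzForm ℤ n v v :=
      Int.ofNat_natAbs_of_nonpos hv.le
    rw [← habcd] at this
    push_cast at this
    exact ⟨a, b, c, d, by linarith⟩
  let s : Fin 6 → Fin (n + 1) → ℤ := fun i => Pi.single (Fin.castLE (by omega) i) 1
  have hs : ∀ i j, lorentzForm ℤ n (s i) (s j) =
      if i = j then (if i = 0 then 1 else -1) else 0 := by
    intro i j
    have := isLorentzFamily_single ℤ n (Fin.castLE (by omega) i) (Fin.castLE (by omega) j)
    rw [this]
    simp only [Fin.ext_iff, Fin.val_castLE, Fin.val_zero]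
  obtain ⟨k, q, hk, hkq, hq, hq0⟩ : ∃ k q, lorentzForm ℤ n k k = lorentzForm ℤ n v v ∧
      lorentzForm ℤ n q k = 0 ∧ lorentzForm ℤ n q q = 0 ∧ q ≠ 0 := by
    refine ⟨a • s 1 + b • s 2 + c • s 3 + d • s 4, s 0 + s 5,
      ?_, ?_, ?_, ?_⟩
    · rw [hN]
      simp [hs, -zsmul_eq_mul]
      ring
    · simp [hs, -zsmul_eq_mul]
    · simp [hs]
    · intro h
      have : lorentzForm ℤ n (s 0) (s 0 + s 5) = 0 := by rw [h, map_zero]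
      simp [hs] at this
  obtain ⟨ε, hε, hne⟩ : ∃ ε : ℤ, ε * ε = 1 ∧
      lorentzForm ℤ n v v - ε * lorentzForm ℤ n v k ≠ 0 := by
    by_cases h : lorentzForm ℤ n v v - lorentzForm ℤ n v k = 0
    · exact ⟨-1, by norm_num, by omega⟩
    · exact ⟨1, by norm_num, by omega⟩
  have hkv : lorentzForm ℤ n k v = lorentzForm ℤ n v k := lorentzForm_comm _ _
  set r := v - ε • k with hr
  have hrv : lorentzForm ℤ n r v = lorentzForm ℤ n v v - ε * lorentzForm ℤ n v k := by
    simp only [hr, map_sub, map_smul, LinearMap.sub_apply, LinearMap.smul_apply, smul_eq_mul, hkv]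
  have hrr : lorentzForm ℤ n r r = 2 * lorentzForm ℤ n r v := by
    rw [hrv]
    simp only [hr, map_sub, map_smul, LinearMap.sub_apply, LinearMap.smul_apply, smul_eq_mul, hkv,
      hk]
    linear_combination lorentzForm ℤ n v v * hε
  have hqr : lorentzForm ℤ n q r = lorentzForm ℤ n q v := by
    simp only [hr, map_sub, map_smul, smul_eq_mul, hkq]
    ring
  have hrq : lorentzForm ℤ n r q = lorentzForm ℤ n q v := by rw [lorentzForm_comm, hqr]
  have hrv0 : lorentzForm ℤ n r v ≠ 0 := by rwa [hrv]
  set u := lorentzForm ℤ n r r • q - (2 * lorentzForm ℤ n q r) • r with hu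
  have hu0 : u ≠ 0 := by
    intro h
    have h1 : lorentzForm ℤ n r u = 0 := by rw [h, map_zero]
    simp only [hu, map_sub, map_smul, smul_eq_mul, hqr, hrq, hrr] at h1
    have h2 : lorentzForm ℤ n q v = 0 := by
      have : lorentzForm ℤ n r v * lorentzForm ℤ n q v = 0 := by linarith
      exact (mul_eq_zero.1 this).resolve_left hrv0
    rw [hu, hqr, h2, mul_zero, zero_smul, sub_zero, hrr] at h
    rcases smul_eq_zero.1 h with h | h
    · omega
    · exact hq0 h
  have huu : lorentzForm ℤ n u u = 0 := by
    simp only [hu, map_sub, map_smul, LinearMap.sub_apply, LinearMap.smul_apply, smul_eq_mul, hqr,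
      hrq, hq]
    ring
  have huv : lorentzForm ℤ n u v = 0 := by
    simp only [hu, map_sub, map_smul, LinearMap.sub_apply, LinearMap.smul_apply, smul_eq_mul, hqr,
      hrr]
    ring
  obtain ⟨g, hg, z, hz, hy⟩ := exists_eq_smul_primitive hu0
  refine ⟨z, ?_, ?_, hy⟩
  · simpa [hz, hg.ne', -zsmul_eq_mul] using huu
  · simpa [hz, hg.ne', -zsmul_eq_mul] using huv

lemma exists_odd_add_mul_abs_le {a d : ℤ} (hd : 0 < d) (h : Odd a ∨ Odd d) :
    ∃ t, Odd (a + t * d) ∧ |a + t * d| ≤ d := by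
  obtain ⟨t₀, ht₀⟩ : ∃ t₀, Odd (a + t₀ * d) := by
    by_cases ha : Odd a
    · exact ⟨0, by simpa using ha⟩
    · refine ⟨1, ?_⟩
      rw [one_mul]
      exact (Int.not_odd_iff_even.1 ha).add_odd (h.resolve_left ha)
  have h1 := Int.emod_nonneg (a + t₀ * d) (show 2 * d ≠ 0 by omega)
  have h2 := Int.emod_lt_of_pos (a + t₀ * d) (show 0 < 2 * d by omega)
  have h3 := Int.emod_add_mul_ediv (a + t₀ * d) (2 * d)
  set q := (a + t₀ * d) / (2 * d)
  set r := (a + t₀ * d) % (2 * d)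
  by_cases hr : r ≤ d
  · have e : a + (t₀ - 2 * q) * d = r := by linear_combination -h3
    refine ⟨t₀ - 2 * q, ?_, ?_⟩
    · rw [show a + (t₀ - 2 * q) * d = a + t₀ * d - 2 * (q * d) by ring]
      exact ht₀.sub_even (even_two_mul _)
    · rw [e, abs_le]
      constructor <;> linarith
  · have e : a + (t₀ - 2 * q - 2) * d = r - 2 * d := by linear_combination -h3
    refine ⟨t₀ - 2 * q - 2, ?_, ?_⟩
    · rw [show a + (t₀ - 2 * q - 2) * d = a + t₀ * d - 2 * (q * d + d) by ring]
      exact ht₀.sub_even (even_two_mul _)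
    · rw [e, abs_le]
      constructor <;> linarith

/-- Given an isotropic vector `z` orthogonal to a primitive characteristic vector `v` of negative
norm, there is a vector `y` pairing to `1` with `z` and to a small odd number with `v`. -/
lemma exists_small_odd_pairing {n : ℕ} {v z : Fin (n + 1) → ℤ}
    (hprim : ∃ w, lorentzForm ℤ n w v = 1)
    (hchar : ∀ x, (2 : ℤ) ∣ lorentzForm ℤ n v x - lorentzForm ℤ n x x)
    (hneg : lorentzForm ℤ n v v < 0) (hz : lorentzForm ℤ n z z = 0)
    (hzv : lorentzForm ℤ n z v = 0) (hy : ∃ y, lorentzForm ℤ n y z = 1) :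
    ∃ y, lorentzForm ℤ n y z = 1 ∧ (∃ k, lorentzForm ℤ n y y = 2 * k + 1) ∧
      (|lorentzForm ℤ n y v| = 1 ∨ lorentzForm ℤ n y v ^ 2 < -lorentzForm ℤ n v v) := by
  obtain ⟨y, hyz⟩ := hy
  obtain ⟨w, hw⟩ := hprim
  have hvz : lorentzForm ℤ n v z = 0 := by rw [lorentzForm_comm, hzv]
  set a := lorentzForm ℤ n y v with ha
  have hu : v - a • z ≠ 0 := by
    intro h
    have hv := sub_eq_zero.1 h
    have : lorentzForm ℤ n v v = 0 := by
      rw [hv]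
      simp [hz, -zsmul_eq_mul]
    omega
  obtain ⟨d, hd, m, hm, x, hx⟩ := exists_eq_smul_primitive hu
  have hnorm : lorentzForm ℤ n v v = d ^ 2 * lorentzForm ℤ n m m := by
    have h1 : lorentzForm ℤ n (v - a • z) (v - a • z) = lorentzForm ℤ n v v := by
      simp [hz, hzv, hvz, -zsmul_eq_mul]
    rw [← h1, hm]
    simp only [map_smul, LinearMap.smul_apply, smul_eq_mul]
    ring
  have hd2 : d ^ 2 ≤ -lorentzForm ℤ n v v := by
    have : lorentzForm ℤ n m m < 0 := by
      by_contra! h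
      nlinarith [mul_nonneg (sq_nonneg d) h]
    nlinarith [sq_nonneg d]
  have hcop : IsCoprime a d := by
    refine ⟨lorentzForm ℤ n w z, lorentzForm ℤ n w m, ?_⟩
    have hv : v = a • z + d • m := by rw [← hm, add_sub_cancel]
    rw [hv] at hw
    simp only [map_add, map_smul, smul_eq_mul] at hw
    linarith
  have hodd : Odd a ∨ Odd d := by
    by_contra! h
    rw [Int.not_odd_iff_even, Int.not_odd_iff_even] at h
    have := hcop.isUnit_of_dvd' h.1.two_dvd h.2.two_dvd
    norm_num [Int.isUnit_iff] at this
  obtain ⟨t, ht, htd⟩ := exists_odd_add_mul_abs_le hd hodd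
  set x' := x - lorentzForm ℤ n x z • y with hx'
  have hx'z : lorentzForm ℤ n x' z = 0 := by
    simp [hx', hyz, -zsmul_eq_mul]
  have hx'v : lorentzForm ℤ n x' v = d := by
    have h1 : lorentzForm ℤ n x (v - a • z) = d := by
      rw [hm, map_smul, hx, smul_eq_mul, mul_one]
    simp only [map_sub, map_smul, smul_eq_mul] at h1
    simp only [hx', map_sub, map_smul, LinearMap.sub_apply, LinearMap.smul_apply, smul_eq_mul, ← ha]
    linarith
  have hyv : lorentzForm ℤ n (y + t • x') v = a + t * d := by
    simp only [map_add, map_smul, LinearMap.add_apply, LinearMap.smul_apply, smul_eq_mul, hx'v, ← ha]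
  refine ⟨y + t • x', ?_, ?_, ?_⟩
  · simp [hyz, hx'z, -zsmul_eq_mul]
  · have h1 := hchar (y + t • x')
    rw [lorentzForm_comm v, hyv] at h1
    obtain ⟨c, hc⟩ := ht
    rw [hc] at h1
    obtain ⟨k, hk⟩ := h1
    exact ⟨c - k, by linarith⟩
  · rw [hyv]
    rcases htd.lt_or_eq with h | h
    · right
      have := sq_lt_sq' (neg_lt_of_abs_lt h) (lt_of_abs_lt h)
      linarith
    · left
      have h1 : d ∣ a + t * d := by
        rw [← dvd_abs, h]
      have h2 : d ∣ a := (dvd_add_left (dvd_mul_left d t)).1 h1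
      have := hcop.isUnit_of_dvd' h2 dvd_rfl
      rcases Int.isUnit_iff.1 this with h3 | h3
      · rw [h, h3]
      · omega

lemma exists_splitting (n : ℕ) : ∀ v : Fin (n + 1) → ℤ, (∃ w, lorentzForm ℤ n w v = 1) →
    (∀ x, (2 : ℤ) ∣ lorentzForm ℤ n v x - lorentzForm ℤ n x x) →
    lorentzForm ℤ n v v < 0 → 5 - (n : ℤ) ≤ lorentzForm ℤ n v v →
    ∃ e p x, lorentzForm ℤ n e e = -1 ∧ lorentzForm ℤ n p p = 1 ∧ lorentzForm ℤ n p e = 0 ∧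
      lorentzForm ℤ n e v = 1 ∧ lorentzForm ℤ n x e = 0 ∧ lorentzForm ℤ n x v = 1 := by
  induction n with
  | zero =>
    intro v _ _ h1 h2
    push_cast at h2
    omega
  | succ n ih =>
    intro v hprim hchar hneg hle
    push_cast at hle
    obtain ⟨z, hz, hzv, hy⟩ := exists_isotropic_orthogonal (by omega) hneg
    obtain ⟨y, hyz, ⟨k, hk⟩, hyv⟩ := exists_small_odd_pairing hprim hchar hneg hz hzv hy
    obtain ⟨hp, he, hep⟩ := exists_norm_one_norm_neg_one hz hyz hk
    have hpv : lorentzForm ℤ (n + 1) (y - k • z) v = lorentzForm ℤ (n + 1) y v := by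
      simp [hzv, -zsmul_eq_mul]
    have hev : lorentzForm ℤ (n + 1) (y - k • z - z) v = lorentzForm ℤ (n + 1) y v := by
      simp [hzv, -zsmul_eq_mul]
    set a := lorentzForm ℤ (n + 1) y v with ha
    set p := y - k • z
    set e := p - z
    rw [lorentzForm_comm] at hep
    by_cases ha1 : |a| = 1
    · have haa : a * a = 1 := by rw [← abs_mul_abs_self, ha1, one_mul]
      refine ⟨a • e, p, a • p, ?_, hp, ?_, ?_, ?_, ?_⟩ <;>
      · simp only [map_smul, LinearMap.smul_apply, smul_eq_mul, he, hep, hev, hpv]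
        linarith
    · have hlt := hyv.resolve_left ha1
      obtain ⟨g, hg, hge⟩ := exists_equiv_last (by omega) he hp hep
      have hsymm : ∀ x y, lorentzForm ℤ (n + 1) (g.symm x) (g.symm y) =
          lorentzForm ℤ (n + 1) x y := fun x y => by
        rw [← hg, g.apply_symm_apply, g.apply_symm_apply]
      have hsymmv : ∀ x, lorentzForm ℤ (n + 1) (g.symm x) v = lorentzForm ℤ (n + 1) x (g v) :=
        fun x => by rw [← hg, g.apply_symm_apply]
      have hlast : ∀ x, lorentzForm ℤ (n + 1) x e = -g x (Fin.last (n + 1)) := by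
        intro x
        rw [← hg, hge, lorentzForm_single, if_neg (Fin.last_pos).ne', neg_one_mul]
      have hgv : g v = (Fin.snoc (Fin.init (g v)) (-a) : Fin (n + 2) → ℤ) := by
        rw [← hev, lorentzForm_comm, hlast, neg_neg, Fin.snoc_init_self]
      have hgp : g p = (Fin.snoc (Fin.init (g p)) 0 : Fin (n + 2) → ℤ) := by
        have := hlast p
        rw [hep, eq_comm, neg_eq_zero] at this
        rw [← this, Fin.snoc_init_self]
      set v' : Fin (n + 1) → ℤ := Fin.init (g v)
      set p' : Fin (n + 1) → ℤ := Fin.init (g p)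
      have hv' : ∀ (x : Fin (n + 1) → ℤ) (c : ℤ),
          lorentzForm ℤ (n + 1) (Fin.snoc x c : Fin (n + 2) → ℤ) (g v) =
            lorentzForm ℤ n x v' + c * a := by
        intro x c
        rw [hgv, lorentzForm_snoc]
        ring
      have hnorm : lorentzForm ℤ n v' v' = lorentzForm ℤ (n + 1) v v + a ^ 2 := by
        rw [← hg v v, hgv, lorentzForm_snoc]
        ring
      have hp'v' : lorentzForm ℤ n p' v' = a := by
        rw [← hpv, ← hg, hgp, hv']
        ring
      have ha2 : 1 ≤ a ^ 2 := by
        have hodd : Odd a := by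
          have h1 := hchar y
          rw [lorentzForm_comm, ← ha, hk] at h1
          obtain ⟨c, hc⟩ := h1
          exact ⟨c + k, by linarith⟩
        have : a ≠ 0 := by
          rintro h
          rw [h] at hodd
          norm_num at hodd
        have := sq_pos_of_ne_zero this
        omega
      have hprim' : ∃ w, lorentzForm ℤ n w v' = 1 := by
        obtain ⟨w, hw⟩ := hprim
        rw [← hg, ← Fin.snoc_init_self (g w), hv'] at hw
        refine ⟨Fin.init (g w) + g w (Fin.last (n + 1)) • p', ?_⟩
        rw [map_add, LinearMap.add_apply, map_smul, LinearMap.smul_apply, hp'v', smul_eq_mul, hw]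
      have hchar' : ∀ x, (2 : ℤ) ∣ lorentzForm ℤ n v' x - lorentzForm ℤ n x x := by
        intro x
        have := hchar (g.symm (Fin.snoc x 0 : Fin (n + 2) → ℤ))
        rw [lorentzForm_comm, hsymmv, hsymm, hv', lorentzForm_snoc] at this
        rw [lorentzForm_comm]
        simpa using this
      obtain ⟨e', q, x, he', hq, hqe, hev', hxe, hxv⟩ :=
        ih v' hprim' hchar' (by linarith) (by linarith)
      refine ⟨g.symm (Fin.snoc e' 0 : Fin (n + 2) → ℤ), g.symm (Fin.snoc q 0 : Fin (n + 2) → ℤ),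
        g.symm (Fin.snoc x 0 : Fin (n + 2) → ℤ), ?_, ?_, ?_, ?_, ?_, ?_⟩
      · rw [hsymm, lorentzForm_snoc, he']; ring
      · rw [hsymm, lorentzForm_snoc, hq]; ring
      · rw [hsymm, lorentzForm_snoc, hqe]; ring
      · rw [hsymmv, hv', hev']; ring
      · rw [hsymm, lorentzForm_snoc, hxe]; ring
      · rw [hsymmv, hv', hxv]; ring

/-- Some linear isometry of the lattice `I_{1,n}` maps `v` to `w`. -/
def LorentzMapsTo (n : ℕ) (v w : Fin (n + 1) → ℤ) : Prop :=
  ∃ f : (Fin (n + 1) → ℤ) →ₗ[ℤ] (Fin (n + 1) → ℤ),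
    (∀ x y, lorentzForm ℤ n (f x) (f y) = lorentzForm ℤ n x y) ∧ f v = w

namespace LorentzMapsTo

variable {n : ℕ} {u v w : Fin (n + 1) → ℤ}

protected lemma refl (v : Fin (n + 1) → ℤ) : LorentzMapsTo n v v :=
  ⟨LinearMap.id, fun _ _ => rfl, rfl⟩

protected lemma trans (h₁ : LorentzMapsTo n u v) (h₂ : LorentzMapsTo n v w) :
    LorentzMapsTo n u w := by
  obtain ⟨f, hf, rfl⟩ := h₁
  obtain ⟨g, hg, rfl⟩ := h₂
  exact ⟨g.comp f, fun x y => by simp [hf, hg], rfl⟩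

lemma norm_eq (h : LorentzMapsTo n v w) : lorentzForm ℤ n w w = lorentzForm ℤ n v v := by
  obtain ⟨f, hf, rfl⟩ := h
  exact hf v v

lemma exists_pairing_eq_one (h : LorentzMapsTo n v w) (hv : ∃ x, lorentzForm ℤ n x v = 1) :
    ∃ x, lorentzForm ℤ n x w = 1 := by
  obtain ⟨f, hf, rfl⟩ := h
  obtain ⟨x, hx⟩ := hv
  exact ⟨f x, by rw [hf, hx]⟩

lemma reflection (v : Fin (n + 1) → ℤ) {r : Fin (n + 1) → ℤ} {c : ℤ}
    (hc : c * lorentzForm ℤ n r r = -2) :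
    LorentzMapsTo n v (v + (c * lorentzForm ℤ n v r) • r) := by
  refine ⟨LinearMap.id + (c • (lorentzForm ℤ n).flip r).smulRight r, fun x y => ?_, ?_⟩
  · have hflip : ∀ x, (lorentzForm ℤ n).flip r x = lorentzForm ℤ n x r := fun _ => rfl
    simp only [LinearMap.add_apply, LinearMap.id_apply, LinearMap.smulRight_apply,
      LinearMap.smul_apply, hflip, map_add, map_smul, smul_eq_mul, lorentzForm_comm r y]
    linear_combination (c * lorentzForm ℤ n x r * lorentzForm ℤ n y r) * hc
  · simp

lemma abs (v : Fin (n + 1) → ℤ) : LorentzMapsTo n v fun i => |v i| := by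
  have hε : ∀ i, ∃ ε : ℤ, ε * ε = 1 ∧ ε * v i = |v i| := by
    intro i
    rcases abs_cases (v i) with ⟨h, -⟩ | ⟨h, -⟩
    · exact ⟨1, by norm_num, by rw [h, one_mul]⟩
    · exact ⟨-1, by norm_num, by rw [h, neg_one_mul]⟩
  choose ε hε hv using hε
  refine ⟨LinearMap.pi fun i => ε i • LinearMap.proj i, fun x y => ?_, ?_⟩
  · rw [lorentzForm_apply, lorentzForm_apply]
    refine Finset.sum_congr rfl fun i _ => ?_
    simp only [LinearMap.pi_apply, LinearMap.smul_apply, LinearMap.proj_apply, smul_eq_mul]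
    linear_combination ((if i = 0 then 1 else -1) * (x i * y i)) * hε i
  · ext i
    simpa using hv i

end LorentzMapsTo

/-- The vector `(3, 1, …, 1)`. -/
def threeOnes (n : ℕ) : Fin (n + 1) → ℤ := fun i => if i = 0 then 3 else 1

lemma lorentzForm_self_eq {n : ℕ} (v : Fin (n + 1) → ℤ) :
    lorentzForm ℤ n v v = v 0 ^ 2 - ∑ i ∈ Finset.univ.erase 0, v i ^ 2 := by
  rw [lorentzForm_apply, ← Finset.add_sum_erase _ _ (Finset.mem_univ 0), sub_eq_add_neg,
    ← Finset.sum_neg_distrib]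
  refine congrArg₂ _ (by simp [sq]) (Finset.sum_congr rfl fun i hi => ?_)
  rw [if_neg (Finset.ne_of_mem_erase hi)]
  ring

/-- Some reflection of the lattice preserves the parity of the entries of `v` and decreases the
absolute value of its time coordinate. -/
def HasDescent {n : ℕ} (v : Fin (n + 1) → ℤ) : Prop :=
  ∃ (r : Fin (n + 1) → ℤ) (c : ℤ), c * lorentzForm ℤ n r r = -2 ∧
    Even (c * lorentzForm ℤ n v r) ∧ |v 0 + c * lorentzForm ℤ n v r * r 0| < v 0

lemma eq_threeOnes_or_hasDescent_two {v : Fin 3 → ℤ} (hpos : ∀ i, 0 < v i)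
    (hodd : ∀ i, Odd (v i)) (hnorm : lorentzForm ℤ 2 v v = 7) :
    v = threeOnes 2 ∨ HasDescent v := by
  rw [lorentzForm_apply_succ, Fin.sum_univ_two] at hnorm
  change v 0 * v 0 - (v 1 * v 1 + v 2 * v 2) = 7 at hnorm
  have h0 := hpos 0
  have h1 := hpos 1
  have h2 := hpos 2
  obtain ⟨a, ha⟩ := hodd 0
  obtain ⟨b, hb⟩ := hodd 1
  obtain ⟨c, hc⟩ := hodd 2
  by_cases h : v 0 < v 1 + v 2
  · right
    have hr : lorentzForm ℤ 2 v (fun _ => 1) = v 0 - v 1 - v 2 := by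
      rw [lorentzForm_apply_succ, Fin.sum_univ_two]
      change v 0 * 1 - (v 1 * 1 + v 2 * 1) = _
      ring
    refine ⟨fun _ => 1, 2, ?_, ?_, ?_⟩
    · rw [lorentzForm_apply_succ, Fin.sum_univ_two]
      norm_num
    · exact even_two_mul _
    · rw [hr, abs_lt]
      constructor
      · nlinarith [sq_nonneg (v 1 - v 2)]
      · linarith
  · left
    have hle : v 1 + v 2 + 1 ≤ v 0 := by omega
    have h12 : v 1 * v 2 + v 1 + v 2 ≤ 3 := by nlinarith
    have e1 : v 1 = 1 := by
      by_contra hne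
      have : 3 ≤ v 1 := by omega
      nlinarith
    have e2 : v 2 = 1 := by
      by_contra hne
      have : 3 ≤ v 2 := by omega
      nlinarith
    have e0 : v 0 = 3 := by
      rw [e1, e2] at hnorm
      nlinarith
    ext i
    fin_cases i
    · exact e0
    · exact e1
    · exact e2

lemma exists_three_largest_s4 {n : ℕ} (hn : 3 ≤ n) (v : Fin (n + 1) → ℤ) :
    ∃ i j k, i ≠ 0 ∧ j ≠ 0 ∧ k ≠ 0 ∧ j ≠ i ∧ k ≠ i ∧ k ≠ j ∧ v j ≤ v i ∧ v k ≤ v j ∧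
      ∃ S : Finset (Fin (n + 1)), S.card + 3 = n ∧ (∀ l ∈ S, v l ≤ v k) ∧
        (∀ l, l = 0 ∨ l = i ∨ l = j ∨ l = k ∨ l ∈ S) ∧
        ∑ l ∈ Finset.univ.erase 0, v l ^ 2 = v i ^ 2 + v j ^ 2 + v k ^ 2 + ∑ l ∈ S, v l ^ 2 := by
  set S₀ : Finset (Fin (n + 1)) := Finset.univ.erase 0 with hS₀
  have hc₀ : S₀.card = n := by simp [hS₀]
  obtain ⟨i, hi, hmi⟩ := S₀.exists_max_image v (Finset.card_pos.1 (by omega))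
  have hc₁ := Finset.card_erase_add_one hi
  obtain ⟨j, hj, hmj⟩ := (S₀.erase i).exists_max_image v (Finset.card_pos.1 (by omega))
  have hc₂ := Finset.card_erase_add_one hj
  obtain ⟨k, hk, hmk⟩ := ((S₀.erase i).erase j).exists_max_image v
    (Finset.card_pos.1 (by omega))
  have hc₃ := Finset.card_erase_add_one hk
  simp only [hS₀, Finset.mem_erase, Finset.mem_univ, and_true] at hi hj hk
  refine ⟨i, j, k, hi, hj.2, hk.2.2, hj.1, hk.2.1, hk.1, hmi j (by simp [hS₀, hj]),
    hmj k (by simp [hS₀, hk]), ((S₀.erase i).erase j).erase k, by omega,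
    fun l hl => hmk l (Finset.mem_of_mem_erase hl), ?_, ?_⟩
  · intro l
    simp only [hS₀, Finset.mem_erase, Finset.mem_univ, and_true]
    tauto
  · rw [← Finset.add_sum_erase S₀ _ (a := i) (by simp [hS₀, hi]),
      ← Finset.add_sum_erase (S₀.erase i) _ (a := j) (by simp [hS₀, hj]),
      ← Finset.add_sum_erase ((S₀.erase i).erase j) _ (a := k) (by simp [hS₀, hk])]
    ring

lemma eq_threeOnes_or_hasDescent {n : ℕ} (hn : 3 ≤ n) (hn9 : n ≤ 9) {v : Fin (n + 1) → ℤ}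
    (hpos : ∀ i, 0 < v i) (hodd : ∀ i, Odd (v i)) (hprim : ∃ w, lorentzForm ℤ n w v = 1)
    (hnorm : lorentzForm ℤ n v v = 9 - n) :
    v = threeOnes n ∨ HasDescent v := by
  obtain ⟨i, j, k, hi, hj, hk, hji, hki, hkj, hvji, hvkj, S, hS, hSk, hcover, hsum⟩ :=
    exists_three_largest_s4 hn v
  rw [lorentzForm_self_eq, hsum] at hnorm
  have hS0 : 0 ≤ ∑ l ∈ S, v l ^ 2 := Finset.sum_nonneg fun l _ => sq_nonneg _
  have hn9' : (n : ℤ) ≤ 9 := by exact_mod_cast hn9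
  have h0 := hpos 0
  have hk0 := hpos k
  by_cases h : v 0 < v i + v j + v k
  · right
    set r : Fin (n + 1) → ℤ := Pi.single 0 1 + Pi.single i 1 + Pi.single j 1 + Pi.single k 1
      with hr
    have hvr : ∀ u, lorentzForm ℤ n u r = u 0 - u i - u j - u k := by
      intro u
      simp only [hr, map_add, lorentzForm_single, if_pos, if_neg hi, if_neg hj, if_neg hk]
      ring
    have hr0 : r 0 = 1 := by simp [hr, hi.symm, hj.symm, hk.symm]
    refine ⟨r, 1, ?_, ?_, ?_⟩
    · have hri : r i = 1 := by simp [hr, hi, hji.symm, hki.symm]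
      have hrj : r j = 1 := by simp [hr, hj, hji, hkj.symm]
      have hrk : r k = 1 := by simp [hr, hk, hki, hkj]
      rw [hvr, hr0, hri, hrj, hrk]
      norm_num
    · rw [hvr, one_mul]
      exact (((hodd 0).sub_odd (hodd i)).sub_odd (hodd j)).sub_odd (hodd k)
    · rw [hvr, hr0, abs_lt]
      constructor
      · have hlt : (v i + v j + v k) ^ 2 < (3 * v 0) ^ 2 := by
          linarith [sq_nonneg (v i - v j), sq_nonneg (v i - v k), sq_nonneg (v j - v k),
            pow_pos h0 2]
        have := lt_of_pow_lt_pow_left₀ 2 (by linarith) hlt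
        linarith
      · linarith
  · left
    push Not at h
    set t := v k with ht
    have hDnn : ∀ l ∈ S, 0 ≤ t ^ 2 - v l ^ 2 := fun l hl =>
      sub_nonneg.2 (pow_le_pow_left₀ (hpos l).le (hSk l hl) 2)
    have hD : ∑ l ∈ S, (t ^ 2 - v l ^ 2) = (n - 3) * t ^ 2 - ∑ l ∈ S, v l ^ 2 := by
      rw [Finset.sum_sub_distrib, Finset.sum_const, nsmul_eq_mul]
      have hSc : (S.card : ℤ) + 3 = n := by exact_mod_cast hS
      linear_combination t ^ 2 * hSc
    have hD0 := Finset.sum_nonneg hDnn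
    have hsq : (v i + v j + t) ^ 2 ≤ v 0 ^ 2 :=
      pow_le_pow_left₀ (by linarith) h 2
    have h9 : 0 ≤ (9 - (n : ℤ)) * (t ^ 2 - 1) :=
      mul_nonneg (by linarith) (sub_nonneg.2 (one_le_pow₀ hk0))
    have hij : t * t ≤ v i * v j := mul_le_mul (hvkj.trans hvji) hvkj hk0.le (hpos i).le
    have hit : t * t ≤ v i * t := mul_le_mul_of_nonneg_right (hvkj.trans hvji) hk0.le
    have hjt : t * t ≤ v j * t := mul_le_mul_of_nonneg_right hvkj hk0.le
    have hup : v i * v j + v i * t + v j * t ≤ 3 * (t * t) := by linarith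
    have hei : v i = t :=
      le_antisymm (le_of_mul_le_mul_right (by linarith) hk0) (hvkj.trans hvji)
    have hej : v j = t := le_antisymm (le_of_mul_le_mul_right (by linarith) hk0) hvkj
    rw [hei, hej] at hnorm hsq
    have hDz : ∑ l ∈ S, (t ^ 2 - v l ^ 2) = 0 := by linarith
    have h9z : (9 - (n : ℤ)) * (t ^ 2 - 1) = 0 := by linarith
    have heS : ∀ l ∈ S, v l = t := by
      intro l hl
      have := (Finset.sum_eq_zero_iff_of_nonneg hDnn).1 hDz l hl
      exact (pow_left_inj₀ (hpos l).le hk0.le two_ne_zero).1 (sub_eq_zero.1 this).symm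
    have he0 : v 0 = 3 * t := by
      have : v 0 ^ 2 = (3 * t) ^ 2 := by linarith
      exact (pow_left_inj₀ h0.le (by linarith) two_ne_zero).1 this
    have hv : v = t • threeOnes n := by
      ext l
      simp only [Pi.smul_apply, threeOnes, smul_eq_mul]
      by_cases hl : l = 0
      · rw [hl, he0]
        simp [mul_comm]
      · rw [if_neg hl, mul_one]
        rcases hcover l with h | rfl | rfl | rfl | h
        exacts [absurd h hl, hei, hej, rfl, heS l h]
    obtain ⟨w, hw⟩ := hprim
    rw [hv, map_smul, smul_eq_mul] at hw
    have ht1 : t = 1 := Int.eq_one_of_mul_eq_one_right hk0.le hw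
    rw [hv, ht1, one_smul]

lemma lorentzMapsTo_threeOnes_of_odd {n : ℕ} (hn : 2 ≤ n) (hn9 : n ≤ 9) (m : ℕ) :
    ∀ v : Fin (n + 1) → ℤ, (v 0).natAbs = m → (∀ i, Odd (v i)) →
      (∃ w, lorentzForm ℤ n w v = 1) → lorentzForm ℤ n v v = 9 - n →
      LorentzMapsTo n v (threeOnes n) := by
  induction m using Nat.strong_induction_on with
  | _ m ih =>
    intro v hm hodd hprim hnorm
    have habs := LorentzMapsTo.abs v
    set u : Fin (n + 1) → ℤ := fun i => |v i| with hu
    refine habs.trans ?_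
    have huodd : ∀ i, Odd (u i) := fun i => odd_abs.2 (hodd i)
    have hupos : ∀ i, 0 < u i := fun i => by
      refine abs_pos.2 fun h => ?_
      have := hodd i
      rw [h] at this
      norm_num at this
    have huprim := habs.exists_pairing_eq_one hprim
    have hunorm := habs.norm_eq.trans hnorm
    have key : u = threeOnes n ∨ HasDescent u := by
      rcases hn.eq_or_lt with rfl | h3
      · exact eq_threeOnes_or_hasDescent_two hupos huodd (by rw [hunorm]; norm_num)
      · exact eq_threeOnes_or_hasDescent h3 hn9 hupos huodd huprim hunorm
    rcases key with h | ⟨r, c, hc, heven, hlt⟩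
    · rw [h]
      exact .refl _
    · have hrefl := LorentzMapsTo.reflection u hc
      refine hrefl.trans (ih _ ?_ _ rfl ?_ (hrefl.exists_pairing_eq_one huprim)
        (hrefl.norm_eq.trans hunorm))
      · rw [← hm]
        have : u 0 = |v 0| := rfl
        simp only [Pi.add_apply, Pi.smul_apply, smul_eq_mul]
        rw [Int.abs_eq_natAbs] at hlt this
        omega
      · intro i
        simp only [Pi.add_apply, Pi.smul_apply, smul_eq_mul]
        exact (huodd i).add_even (heven.mul_right _)

lemma odd_of_characteristic {n : ℕ} {v : Fin (n + 1) → ℤ}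
    (hv : ∀ x, (2 : ℤ) ∣ lorentzForm ℤ n v x - lorentzForm ℤ n x x) (i : Fin (n + 1)) :
    Odd (v i) := by
  have h := hv (Pi.single i 1)
  rw [lorentzForm_single, lorentzForm_single, Pi.single_eq_same] at h
  rw [Int.odd_iff]
  split_ifs at h <;> omega

lemma lorentzMapsTo_threeOnes_succ {n : ℕ} {v : Fin (n + 2) → ℤ}
    (ih : ∀ v : Fin (n + 1) → ℤ, (∃ w, lorentzForm ℤ n w v = 1) →
      (∀ x, (2 : ℤ) ∣ lorentzForm ℤ n v x - lorentzForm ℤ n x x) →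
      lorentzForm ℤ n v v = 9 - n → LorentzMapsTo n v (threeOnes n))
    (hchar : ∀ x, (2 : ℤ) ∣ lorentzForm ℤ (n + 1) v x - lorentzForm ℤ (n + 1) x x)
    (hnorm : lorentzForm ℤ (n + 1) v v = 8 - n) {e p x : Fin (n + 2) → ℤ}
    (he : lorentzForm ℤ (n + 1) e e = -1) (hp : lorentzForm ℤ (n + 1) p p = 1)
    (hpe : lorentzForm ℤ (n + 1) p e = 0) (hev : lorentzForm ℤ (n + 1) e v = 1)
    (hxe : lorentzForm ℤ (n + 1) x e = 0) (hxv : lorentzForm ℤ (n + 1) x v = 1) :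
    LorentzMapsTo (n + 1) v (threeOnes (n + 1)) := by
  obtain ⟨g, hg, hge⟩ := exists_equiv_last n.succ_ne_zero he hp hpe
  have hlast : ∀ y, g y (Fin.last (n + 1)) = -lorentzForm ℤ (n + 1) y e := by
    intro y
    rw [← hg, hge, lorentzForm_single, if_neg (Fin.last_pos).ne', neg_one_mul, neg_neg]
  have hgv : g v = (Fin.snoc (Fin.init (g v)) (-1) : Fin (n + 2) → ℤ) := by
    rw [← hev, lorentzForm_comm, ← hlast, Fin.snoc_init_self]
  have hgx : g x = (Fin.snoc (Fin.init (g x)) 0 : Fin (n + 2) → ℤ) := by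
    rw [← neg_zero, ← hxe, ← hlast, Fin.snoc_init_self]
  set v' : Fin (n + 1) → ℤ := Fin.init (g v)
  obtain ⟨f, hf, hfv⟩ := ih v' ⟨Fin.init (g x), by
    rw [← hxv, ← hg, hgx, hgv, lorentzForm_snoc, Fin.init_snoc]
    ring⟩ (fun y => by
    have h := hchar (g.symm (Fin.snoc y 0 : Fin (n + 2) → ℤ))
    rw [← hg v, ← hg (g.symm _), g.apply_symm_apply, hgv, lorentzForm_snoc,
      lorentzForm_snoc] at h
    simpa using h) (by
    have h := hg v v
    rw [hgv, lorentzForm_snoc, hnorm] at h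
    linarith)
  let F : (Fin (n + 2) → ℤ) →ₗ[ℤ] (Fin (n + 2) → ℤ) :=
    { toFun := fun y => Fin.snoc (f (Fin.init y)) (-y (Fin.last (n + 1)))
      map_add' := fun y z => by
        have : (Fin.init (y + z) : Fin (n + 1) → ℤ) = Fin.init y + Fin.init z := rfl
        ext i
        refine Fin.lastCases ?_ (fun i => ?_) i
        · simp [add_comm]
        · simp [this]
      map_smul' := fun c y => by
        have : (Fin.init (c • y) : Fin (n + 1) → ℤ) = c • Fin.init y := rfl
        ext i
        refine Fin.lastCases ?_ (fun i => ?_) i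
        · simp
        · simp [this, -zsmul_eq_mul] }
  refine ⟨F.comp g.toLinearMap, fun y z => ?_, ?_⟩
  · rw [← hg y z, ← Fin.snoc_init_self (g y), ← Fin.snoc_init_self (g z), lorentzForm_snoc, ← hf]
    refine (lorentzForm_snoc _ _ _ _).trans ?_
    rw [neg_mul_neg]
    rfl
  · change (Fin.snoc (f v') (-g v (Fin.last (n + 1))) : Fin (n + 2) → ℤ) = _
    rw [hfv, hlast, lorentzForm_comm, hev]
    ext i
    refine Fin.lastCases ?_ (fun i => ?_) i
    · simp [threeOnes]
    · simp [threeOnes]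

lemma lorentzMapsTo_threeOnes {n : ℕ} (hn : 2 ≤ n) :
    ∀ v : Fin (n + 1) → ℤ, (∃ w, lorentzForm ℤ n w v = 1) →
      (∀ x, (2 : ℤ) ∣ lorentzForm ℤ n v x - lorentzForm ℤ n x x) →
      lorentzForm ℤ n v v = 9 - n → LorentzMapsTo n v (threeOnes n) := by
  induction n, hn using Nat.le_induction with
  | base =>
    intro v hprim hchar hnorm
    exact lorentzMapsTo_threeOnes_of_odd le_rfl (by norm_num) _ v rfl
      (odd_of_characteristic hchar) hprim hnorm
  | succ n hn ih =>
    intro v hprim hchar hnorm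
    rcases le_or_gt (n + 1) 9 with h9 | h9
    · exact lorentzMapsTo_threeOnes_of_odd (by omega) h9 _ v rfl
        (odd_of_characteristic hchar) hprim hnorm
    · obtain ⟨e, p, x, he, hp, hpe, hev, hxe, hxv⟩ := exists_splitting (n + 1) v hprim hchar
        (by rw [hnorm]; push_cast; omega) (by rw [hnorm]; linarith)
      exact lorentzMapsTo_threeOnes_succ ih hchar (by rw [hnorm]; push_cast; ring)
        he hp hpe hev hxe hxv

/-- For every `n ≥ 2`, every primitive characteristic vector of norm `9 - n` in
`I_{1,n}` lies in the automorphism orbit of `(3, 1, 1, …, 1)`. -/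
theorem orbit_of_three_one_one (n : ℕ) (hn : 2 ≤ n)
    (v : Fin (n + 1) → ℤ)
    (hv_prim : PrimitiveI n v) (hv_char : CharacteristicI n v)
    (hv_norm : formI n v v = 9 - (n : ℤ)) :
    ∃ M : Matrix (Fin (n + 1)) (Fin (n + 1)) ℤ,
      Mᵀ * OmegaI n * M = OmegaI n ∧
        M.mulVec v = (fun i => if i = 0 then 3 else 1) := by
  have hform : ∀ x y, formI n x y = lorentzForm ℤ n x y := fun x y => by
    rw [lorentzForm, Matrix.toBilin'_apply']
    rfl
  obtain ⟨f, hf, hfv⟩ := lorentzMapsTo_threeOnes hn v (exists_lorentzForm_eq_one_of_gcd hv_prim)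
    (fun x => by
      rw [← hform, ← hform]
      exact (hv_char x).symm.dvd)
    (by rw [← hform, hv_norm])
  refine ⟨LinearMap.toMatrix' f, ?_, ?_⟩
  · apply Matrix.toBilin'.injective
    rw [← Matrix.toBilin'_comp, Matrix.toLin'_toMatrix']
    exact LinearMap.ext₂ hf
  · rw [LinearMap.toMatrix'_mulVec, hfv]
    rfl
end

section
/- Let T be a natural number and x : Fin T → ℤ a vector of integers satisfying Σᵢ (xᵢ)² = (Σᵢ xᵢ) + 2. Then there is exactly one index j with xᵢ ∉ {0,1}, and for this index either x_j = −1 or x_j = 2. Consequently, up to permutation of its entries, x has the form (−1, 1, …, 1, 0, …, 0) or (2, 1, …, 1, 0, …, 0). -/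
theorem Int.mul_sub_one_nonneg (a : ℤ) : 0 ≤ a * (a - 1) := by
  rcases le_or_gt a 0 with ha | ha <;> nlinarith

theorem Int.two_le_mul_sub_one {a : ℤ} (ha : a ∉ ({0, 1} : Set ℤ)) : 2 ≤ a * (a - 1) := by
  simp only [Set.mem_insert_iff, Set.mem_singleton_iff, not_or] at ha
  rcases le_or_gt a 0 with h | h
  · have : a ≤ -1 := by omega
    nlinarith
  · have : 2 ≤ a := by omega
    nlinarith

/-- If integers `x₁, …, x_T` satisfy `Σ xᵢ² = (Σ xᵢ) + 2`, then there is exactly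
one index `j` with `x_j ∉ {0,1}`, and any such entry equals `-1` or `2`
(so that, up to permutation, `x` is `(-1,1,…,1,0,…,0)` or `(2,1,…,1,0,…,0)`). -/
theorem unique_entry_outside_zero_one (T : ℕ) (x : Fin T → ℤ)
    (h : ∑ i, (x i) ^ 2 = (∑ i, x i) + 2) :
    (∃! j, x j ∉ ({0, 1} : Set ℤ)) ∧
      (∀ j, x j ∉ ({0, 1} : Set ℤ) → x j = -1 ∨ x j = 2) := by
  have hsum : ∑ i, x i * (x i - 1) = 2 := by
    have : ∑ i, x i * (x i - 1) = ∑ i, (x i) ^ 2 - ∑ i, x i := by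
      rw [← Finset.sum_sub_distrib]
      exact Finset.sum_congr rfl fun i _ => by ring
    linarith
  have hnonneg : ∀ i ∈ Finset.univ, 0 ≤ x i * (x i - 1) :=
    fun i _ => Int.mul_sub_one_nonneg (x i)
  refine ⟨?_, fun j hj => ?_⟩
  · obtain ⟨j, hj⟩ : ∃ j, x j ∉ ({0, 1} : Set ℤ) := by
      by_contra! hall
      have : ∑ i, x i * (x i - 1) = 0 := Finset.sum_eq_zero fun i _ => by
        rcases hall i with hi | hi
        · simp [hi]
        · simp [Set.mem_singleton_iff.mp hi]
      omega
    refine ⟨j, hj, fun k hk => ?_⟩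
    by_contra hkj
    have hle := Finset.add_le_sum hnonneg (Finset.mem_univ k) (Finset.mem_univ j) hkj
    linarith [Int.two_le_mul_sub_one hj, Int.two_le_mul_sub_one hk]
  · have hle := Finset.single_le_sum hnonneg (Finset.mem_univ j)
    have heq : x j * (x j - 1) = 2 :=
      le_antisymm (hle.trans_eq hsum) (Int.two_le_mul_sub_one hj)
    have hfac : (x j + 1) * (x j - 2) = 0 := by linear_combination heq
    rcases mul_eq_zero.mp hfac with h0 | h0
    · left; omega
    · right; omega
end

section
/- There is no automorphism of the lattice I_{1,2} taking (1,5,5) to (1,1,7): there exists no 3×3 integer matrix M with Mᵀ Ω M = Ω and M (1,5,5) = (1,1,7), where Ω = diag(1,−1,−1). (Both vectors are primitive characteristic vectors of norm −49 in I_{1,2}.) -/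
open Matrix

/-- The Gram matrix `Ω = diag(1,-1,-1)` of the lattice `I_{1,2}`. -/
def OmegaI12 : Matrix (Fin 3) (Fin 3) ℤ := !![1, 0, 0; 0, -1, 0; 0, 0, -1]

/-- A matrix preserving a Gram matrix `A` preserves the associated bilinear form. -/
theorem mulVec_dotProduct_mulVec_mulVec_of_transpose_mul_mul_eq {n R : Type*} [Fintype n]
    [CommSemiring R] {M A : Matrix n n R} (h : Mᵀ * A * M = A) (x y : n → R) :
    M *ᵥ x ⬝ᵥ A *ᵥ (M *ᵥ y) = x ⬝ᵥ A *ᵥ y := by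
  conv_rhs => rw [← h]
  rw [← mulVec_mulVec, ← mulVec_mulVec, dotProduct_mulVec x, vecMul_transpose]

theorem dotProduct_OmegaI12_mulVec (x y : Fin 3 → ℤ) :
    x ⬝ᵥ OmegaI12 *ᵥ y = x 0 * y 0 - x 1 * y 1 - x 2 * y 2 := by
  simp [OmegaI12, dotProduct, mulVec, Fin.sum_univ_three]
  ring

/-- The orthogonal complement of `(1,1,7)` in `I_{1,2}` contains no vector of norm `-2`. -/
theorem no_norm_neg_two_orthogonal_117 (a b c : ℤ) (horth : a - b - 7 * c = 0) :
    a * a - b * b - c * c ≠ -2 := by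
  intro hnorm
  obtain rfl : a = b + 7 * c := by linarith
  have h : c * (-(7 * b + 24 * c)) = 1 := by linarith
  rcases Int.eq_one_or_neg_one_of_mul_eq_one h with rfl | rfl <;> omega

/-- There is no automorphism of the lattice `I_{1,2}` taking `(1,5,5)` to
`(1,1,7)`: no 3×3 integer matrix `M` satisfies `Mᵀ Ω M = Ω` and
`M (1,5,5) = (1,1,7)`. -/
theorem no_automorphism_I12_155_to_117 :
    ¬ ∃ M : Matrix (Fin 3) (Fin 3) ℤ,
        Mᵀ * OmegaI12 * M = OmegaI12 ∧
          M.mulVec ![1, 5, 5] = ![1, 1, 7] := by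
  rintro ⟨M, hM, hv⟩
  -- `(0,-1,1)` has norm `-2` and is orthogonal to `(1,5,5)`.
  have horth := mulVec_dotProduct_mulVec_mulVec_of_transpose_mul_mul_eq hM ![0, -1, 1] ![1, 5, 5]
  have hnorm := mulVec_dotProduct_mulVec_mulVec_of_transpose_mul_mul_eq hM ![0, -1, 1] ![0, -1, 1]
  rw [hv] at horth
  generalize M *ᵥ ![0, -1, 1] = y at horth hnorm
  rw [dotProduct_OmegaI12_mulVec, dotProduct_OmegaI12_mulVec] at horth hnorm
  simp only [cons_val] at horth hnorm
  exact no_norm_neg_two_orthogonal_117 (y 0) (y 1) (y 2) (by linarith) (by linarith)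
end

section
/- Let n be a natural number with 3 ≤ n ≤ 9 and let u₀, u₁, …, u_n be odd integers with u₀ > u₁ ≥ u₂ ≥ ⋯ ≥ u_n ≥ 1 and u₀² = u₁² + ⋯ + u_n² + (9 − n). Assume moreover that u₁ > 1 if n < 9, and that u₁ > u₉ if n = 9. Then u₁ + u₂ + u₃ > u₀. -/
/-- A sum of nine squares of positive integers in decreasing order, not all equal, is less than
the square of the sum of the three largest. -/
theorem sum_nine_sq_lt_sq_add_three {a b c d e f g h i : ℤ} (hab : b ≤ a) (hbc : c ≤ b)
    (hcd : d ≤ c) (hde : e ≤ d) (hef : f ≤ e) (hfg : g ≤ f) (hgh : h ≤ g) (hhi : i ≤ h)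
    (hi : 1 ≤ i) (hai : i < a) :
    a ^ 2 + b ^ 2 + c ^ 2 + d ^ 2 + e ^ 2 + f ^ 2 + g ^ 2 + h ^ 2 + i ^ 2 <
      (a + b + c) ^ 2 := by
  have sq_le {x : ℤ} (hx : 1 ≤ x) (hxc : x ≤ c) : x ^ 2 ≤ c ^ 2 :=
    pow_le_pow_left₀ (by linarith) hxc 2
  have hd := sq_le (x := d) (by linarith) (by linarith)
  have he := sq_le (x := e) (by linarith) (by linarith)
  have hf := sq_le (x := f) (by linarith) (by linarith)
  have hg := sq_le (x := g) (by linarith) (by linarith)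
  have hh := sq_le (x := h) (by linarith) (by linarith)
  have hi' := sq_le (x := i) hi (by linarith)
  have hc : 0 < c := by linarith
  have h_ab : c ^ 2 ≤ a * b := by nlinarith
  have h_bc : c ^ 2 ≤ b * c := by nlinarith
  rcases lt_or_ge c a with hca | hac
  · have h_ac : c ^ 2 < a * c := by nlinarith
    linarith [show (a + b + c) ^ 2 = a ^ 2 + b ^ 2 + c ^ 2 + 2 * (a * b + a * c + b * c) by ring]
  · have h_ac : c ^ 2 ≤ a * c := by nlinarith
    have h_ic : i ^ 2 < c ^ 2 := pow_lt_pow_left₀ (by linarith) (by linarith) two_ne_zero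
    linarith [show (a + b + c) ^ 2 = a ^ 2 + b ^ 2 + c ^ 2 + 2 * (a * b + a * c + b * c) by ring]


/-- Let `3 ≤ n ≤ 9` and let `u₀, u₁, …, u_n` be odd integers with
`u₀ > u₁ ≥ u₂ ≥ ⋯ ≥ u_n ≥ 1` and `u₀² = u₁² + ⋯ + u_n² + (9 - n)`.
If moreover `u₁ > 1` when `n < 9`, and `u₁ > u₉` when `n = 9`, then
`u₁ + u₂ + u₃ > u₀`. -/
theorem reflection_decreases_time_component (n : ℕ) (hn3 : 3 ≤ n) (hn9 : n ≤ 9)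
    (u : ℕ → ℤ)
    (hodd : ∀ i ≤ n, Odd (u i))
    (h01 : u 0 > u 1)
    (hmono : ∀ i, 1 ≤ i → i < n → u (i + 1) ≤ u i)
    (hlast : u n ≥ 1)
    (hnorm : u 0 ^ 2 = (∑ i ∈ Finset.Icc 1 n, u i ^ 2) + (9 - (n : ℤ)))
    (hsmall : n < 9 → u 1 > 1)
    (hnine : n = 9 → u 1 > u 9) :
    u 1 + u 2 + u 3 > u 0 := by
  let v : ℕ → ℤ := fun i => if i ≤ n then u i else 1
  have hv {i : ℕ} (h : i ≤ n) : v i = u i := if_pos h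
  have hv_one {i : ℕ} (h : n < i) : v i = 1 := if_neg (by lia)
  have hstep (i : ℕ) (h1 : 1 ≤ i) : v (i + 1) ≤ v i := by
    rcases lt_trichotomy i n with h | rfl | h
    · rw [hv h, hv h.le]
      exact hmono i h1 h
    · rw [hv le_rfl, hv_one i.lt_succ_self]
      exact hlast
    · rw [hv_one h, hv_one (by lia)]
  have h9 : 1 ≤ v 9 ∧ v 9 < v 1 := by
    rw [hv (i := 1) (by lia)]
    rcases hn9.lt_or_eq with h | rfl
    · rw [hv_one h]
      exact ⟨le_rfl, hsmall h⟩
    · rw [hv le_rfl]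
      exact ⟨hlast, hnine rfl⟩
  have hsum : u 0 ^ 2 = v 1 ^ 2 + v 2 ^ 2 + v 3 ^ 2 + v 4 ^ 2 + v 5 ^ 2 + v 6 ^ 2 + v 7 ^ 2 +
      v 8 ^ 2 + v 9 ^ 2 := by
    rw [hnorm]
    interval_cases n <;> simp [hv, hv_one, Finset.sum_Icc_succ_top] <;> ring
  have hlt := sum_nine_sq_lt_sq_add_three (hstep 1 (by lia)) (hstep 2 (by lia))
    (hstep 3 (by lia)) (hstep 4 (by lia)) (hstep 5 (by lia)) (hstep 6 (by lia))
    (hstep 7 (by lia)) (hstep 8 (by lia)) h9.1 h9.2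
  have hpos : 0 ≤ v 1 + v 2 + v 3 := by
    linarith [hstep 1 (by lia), hstep 2 (by lia), hstep 3 (by lia), hstep 4 (by lia),
      hstep 5 (by lia), hstep 6 (by lia), hstep 7 (by lia), hstep 8 (by lia)]
  rw [← hsum] at hlt
  have hres := lt_of_pow_lt_pow_left₀ 2 hpos hlt
  rwa [hv (by lia), hv (by lia), hv (by lia)] at hres
end
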